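/- (Pohozaev identity, Euclidean case.) Let n ≥ 3, r > 0, and write B_r⁺ := {y ∈ ℝⁿ : |y| < r, yₙ > 0}, ∂⁺B_r⁺ := {|y| = r, yₙ > 0}, ∂'B_r⁺ := {y : |ȳ| < r, yₙ = 0}, and ∂(∂'B_r⁺) := {|ȳ| = r, yₙ = 0}. Let p > 1, τ := n/(n-2) - p, let f be a positive C¹ function on a neighborhood of the closure of ∂'B_r⁺ in ℝ^{n-1}, and let u > 0 be a C² function on the closure of B_r⁺ which is harmonic in B_r⁺ and satisfies ∂u/∂yₙ + (n-2)·f^{-τ}·u^p = 0 on ∂'B_r⁺. Define P(u,r) := ∫_{∂⁺B_r⁺} [ ((n-2)/2)·u·∂u/∂r - (r/2)·|∇u|² + r·|∂u/∂r|² ] dσ_r + (r(n-2)/(p+1))·∫_{∂(∂'B_r⁺)} f^{-τ}·u^{p+1} dσ̄. Then P(u,r) = -(τ(n-2)/(p+1))·∫_{∂'B_r⁺} (ȳ·∇̄f)·f^{-τ-1}·u^{p+1} dȳ + ((n-1)/(p+1) - (n-2)/2)·(n-2)·∫_{∂'B_r⁺} f^{-τ}·u^{p+1} dȳ. -/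

import Mathlib

open MeasureTheory

noncomputable section

/-- The index of the last coordinate in `Fin n`. -/
def lastIdx (n : ℕ) [NeZero n] : Fin n :=
  ⟨n - 1, Nat.sub_lt (Nat.pos_of_ne_zero (NeZero.ne n)) Nat.one_pos⟩

/-- The last coordinate `yₙ` of a point `y ∈ ℝⁿ`. -/
def lastCoord (n : ℕ) [NeZero n] (y : EuclideanSpace ℝ (Fin n)) : ℝ :=
  y (lastIdx n)

/-- The closed upper half-space `ℝⁿ₊ = {y : yₙ ≥ 0}`. -/
def halfSpace (n : ℕ) [NeZero n] : Set (EuclideanSpace ℝ (Fin n)) :=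
  {y | 0 ≤ lastCoord n y}

/-- The closure of the half-ball `B_r⁺`, i.e. `closedBall(0,r) ∩ ℝⁿ₊`. -/
def domS (n : ℕ) [NeZero n] (r : ℝ) : Set (EuclideanSpace ℝ (Fin n)) :=
  Metric.closedBall 0 r ∩ halfSpace n

/-- Partial derivative `∂f/∂yᵢ` within the closed half-ball (one-sided at boundary
points). -/
def pdW (n : ℕ) [NeZero n] (r : ℝ) (f : EuclideanSpace ℝ (Fin n) → ℝ) (i : Fin n)
    (y : EuclideanSpace ℝ (Fin n)) : ℝ :=
  fderivWithin ℝ f (domS n r) y (EuclideanSpace.single i 1)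

/-- The embedding `z ↦ (z, 0)` of `ℝ^{n-1}` into `∂ℝⁿ₊ ⊂ ℝⁿ`. -/
def embBdry (n : ℕ) [NeZero n] (z : EuclideanSpace ℝ (Fin (n - 1))) :
    EuclideanSpace ℝ (Fin n) :=
  (EuclideanSpace.equiv (Fin n) ℝ).symm fun i =>
    if h : (i : ℕ) < n - 1 then z ⟨i, h⟩ else 0

/-- The surface measure on the unit sphere of `ℝ^d` (total mass `d · vol(B₁^d)`). -/
def sphereMeasure (d : ℕ) : Measure (Metric.sphere (0 : EuclideanSpace ℝ (Fin d)) 1) :=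
  (volume : Measure (EuclideanSpace ℝ (Fin d))).toSphere


/-- smooth cutoff: `0` for `t ≤ 1`, `1` for `t ≥ 2`. -/
def cutP (t : ℝ) : ℝ := Real.smoothTransition (t - 1)

lemma cutP_contDiff : ContDiff ℝ 1 cutP := by
  unfold cutP
  exact (Real.smoothTransition.contDiff (n := 1)).comp (contDiff_id.sub contDiff_const)

lemma cutP_zero {t : ℝ} (h : t ≤ 1) : cutP t = 0 :=
  Real.smoothTransition.zero_of_nonpos (by linarith)

lemma cutP_one {t : ℝ} (h : 2 ≤ t) : cutP t = 1 :=
  Real.smoothTransition.one_of_one_le (by linarith)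

lemma cutP_nonneg (t : ℝ) : 0 ≤ cutP t := Real.smoothTransition.nonneg _
lemma cutP_le_one (t : ℝ) : cutP t ≤ 1 := Real.smoothTransition.le_one _
lemma cutP_abs (t : ℝ) : |cutP t| ≤ 1 := by
  rw [abs_of_nonneg (cutP_nonneg t)]; exact cutP_le_one t

lemma cutP_cont : Continuous cutP := cutP_contDiff.continuous
lemma cutP_deriv_cont : Continuous (deriv cutP) := cutP_contDiff.continuous_deriv (by norm_num)

lemma cutP_hasDeriv (t : ℝ) : HasDerivAt cutP (deriv cutP t) t :=
  (cutP_contDiff.differentiable (by norm_num) t).hasDerivAt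

lemma cutP_deriv_zero {t : ℝ} (h : t < 1) : deriv cutP t = 0 := by
  have : cutP =ᶠ[nhds t] fun _ => 0 := by
    filter_upwards [Iio_mem_nhds h] with s hs using cutP_zero (le_of_lt hs)
  rw [this.deriv_eq]; simp

lemma cutP_deriv_zero' {t : ℝ} (h : 2 < t) : deriv cutP t = 0 := by
  have : cutP =ᶠ[nhds t] fun _ => 1 := by
    filter_upwards [Ioi_mem_nhds h] with s hs using cutP_one (le_of_lt hs)
  rw [this.deriv_eq]; simp

lemma cutP_deriv_supp : HasCompactSupport (deriv cutP) := by
  apply HasCompactSupport.of_support_subset_isCompact (isCompact_Icc (a := (1:ℝ)) (b := 2))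
  intro t ht
  by_contra hc
  apply ht
  rw [Set.mem_Icc, not_and_or] at hc
  rcases hc with hc | hc
  · exact cutP_deriv_zero (not_le.1 hc)
  · exact cutP_deriv_zero' (not_le.1 hc)

lemma cutP_deriv_int : Integrable (deriv cutP) :=
  cutP_deriv_cont.integrable_of_hasCompactSupport cutP_deriv_supp

lemma cutP_deriv_integral : ∫ t, deriv cutP t = 1 := by
  have h1 : ∫ t in (1:ℝ)..2, deriv cutP t = 1 := by
    rw [intervalIntegral.integral_deriv_eq_sub (fun t _ => cutP_contDiff.differentiable (by norm_num) t)
      (cutP_deriv_cont.intervalIntegrable _ _), cutP_one le_rfl, cutP_zero le_rfl]; norm_num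
  rw [intervalIntegral.integral_of_le (by norm_num)] at h1
  rw [← h1, eq_comm, ← integral_Icc_eq_integral_Ioc]
  apply setIntegral_eq_integral_of_forall_compl_eq_zero
  intro t hc
  rw [Set.mem_Icc, not_and_or] at hc
  rcases hc with hc | hc
  · exact cutP_deriv_zero (not_le.1 hc)
  · exact cutP_deriv_zero' (not_le.1 hc)

lemma conc_subst (K : ℝ) (hK : 0 < K) (H : ℝ → ℝ) :
    ∫ t, K * deriv cutP (K * t) * H t = ∫ v, deriv cutP v * H (v / K) := by
  have := Measure.integral_comp_mul_left (fun v => deriv cutP v * H (v / K)) K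
  rw [show (∫ t, K * deriv cutP (K * t) * H t)
    = K * ∫ t, deriv cutP (K * t) * H (K * t / K) by
      rw [← integral_const_mul]; congr 1; ext t; rw [mul_div_cancel_left₀ _ hK.ne']; ring,
    this, abs_of_pos (inv_pos.2 hK), smul_eq_mul, ← mul_assoc, mul_inv_cancel₀ hK.ne', one_mul]

lemma conc_bound (K : ℝ) (hK : 0 < K) (H : ℝ → ℝ) (C : ℝ) (hC : ∀ t, |H t| ≤ C) :
    |∫ t, K * deriv cutP (K * t) * H t| ≤ (∫ v, |deriv cutP v|) * C := by
  rw [conc_subst K hK, ← integral_mul_const]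
  rw [← Real.norm_eq_abs]
  apply norm_integral_le_of_norm_le (cutP_deriv_int.abs.mul_const C)
  filter_upwards with v
  rw [Real.norm_eq_abs, abs_mul]
  exact mul_le_mul_of_nonneg_left (hC _) (abs_nonneg _)

lemma conc_tendsto (H : ℕ → ℝ → ℝ) (hm : ∀ k, Measurable (H k)) (C : ℝ)
    (hC : ∀ k t, |H k t| ≤ C) (l : ℝ)
    (hl : ∀ v : ℝ, 1 ≤ v → Filter.Tendsto (fun k : ℕ => H k (v / ((k:ℝ) + 1))) Filter.atTop (nhds l)) :
    Filter.Tendsto (fun k : ℕ => ∫ t, ((k:ℝ)+1) * deriv cutP (((k:ℝ)+1) * t) * H k t)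
      Filter.atTop (nhds l) := by
  have e : ∀ k : ℕ, ∫ t, ((k:ℝ)+1) * deriv cutP (((k:ℝ)+1) * t) * H k t
      = ∫ v, deriv cutP v * H k (v / ((k:ℝ)+1)) := fun k => conc_subst _ (by positivity) _
  simp_rw [e]
  have : l = ∫ v, deriv cutP v * l := by rw [integral_mul_const, cutP_deriv_integral, one_mul]
  rw [this]
  apply tendsto_integral_of_dominated_convergence (fun v => |deriv cutP v| * C)
  · intro k
    exact (cutP_deriv_cont.measurable.mul ((hm k).comp (measurable_id.div_const _))).aestronglyMeasurable
  · exact cutP_deriv_int.abs.mul_const C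
  · intro k
    filter_upwards with v
    rw [Real.norm_eq_abs, abs_mul]
    exact mul_le_mul_of_nonneg_left (hC _ _) (abs_nonneg _)
  · filter_upwards with v
    by_cases hv : 1 ≤ v
    · exact (hl v hv).const_mul _
    · simp [cutP_deriv_zero (not_le.1 hv)]

lemma polar {d : ℕ} [Nontrivial (EuclideanSpace ℝ (Fin d))] (g : EuclideanSpace ℝ (Fin d) → ℝ) (hg : Integrable g) :
    ∫ y, g y = ∫ ω : Metric.sphere (0 : EuclideanSpace ℝ (Fin d)) 1,
      (∫ s in Set.Ioi (0:ℝ), s ^ (d-1) * g (s • (ω : EuclideanSpace ℝ (Fin d))))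
      ∂((volume : Measure (EuclideanSpace ℝ (Fin d))).toSphere) := by
  set μ : Measure (EuclideanSpace ℝ (Fin d)) := volume
  have hmp := μ.measurePreserving_homeomorphUnitSphereProd
  have hd : Module.finrank ℝ (EuclideanSpace ℝ (Fin d)) = d := by simp
  set G : Metric.sphere (0 : EuclideanSpace ℝ (Fin d)) 1 × Set.Ioi (0:ℝ) → ℝ :=
    fun q => g ((q.2 : ℝ) • (q.1 : EuclideanSpace ℝ (Fin d))) with hG
  have hGc : ∀ x : ({(0)}ᶜ : Set (EuclideanSpace ℝ (Fin d))),
      G (homeomorphUnitSphereProd _ x) = g x := by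
    intro x
    simp only [hG]
    congr 1
    have := x.2
    simp only [Set.mem_compl_iff, Set.mem_singleton_iff] at this
    have : ‖(x : EuclideanSpace ℝ (Fin d))‖ ≠ 0 := norm_ne_zero_iff.2 this
    simp [smul_smul, this]
  have h1 : ∫ y, g y ∂μ = ∫ q, G q ∂(μ.toSphere.prod (.volumeIoiPow (d - 1))) := by
    rw [hd] at hmp
    rw [← hmp.integral_comp (Homeomorph.measurableEmbedding _) G]
    simp_rw [hGc]
    rw [integral_subtype_comap (measurableSet_singleton _).compl g, restrict_compl_singleton]
  have h2 : Integrable G (μ.toSphere.prod (.volumeIoiPow (d - 1))) := by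
    rw [hd] at hmp
    rw [← hmp.integrable_comp_emb (Homeomorph.measurableEmbedding _)]
    have : G ∘ (homeomorphUnitSphereProd _) = g ∘ Subtype.val := by
      ext x; exact hGc x
    rw [this, ← integrableOn_iff_comap_subtypeVal (measurableSet_singleton _).compl]
    exact hg.integrableOn
  rw [h1, integral_prod _ h2]
  congr 1
  ext ω
  simp only [Measure.volumeIoiPow, ENNReal.ofReal]
  rw [integral_withDensity_eq_integral_smul]
  · simp only [hG]
    rw [integral_subtype_comap measurableSet_Ioi fun a ↦ Real.toNNReal (a ^ (d - 1)) • g (a • (ω : EuclideanSpace ℝ (Fin d)))]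
    apply setIntegral_congr_fun measurableSet_Ioi fun x hx ↦ ?_
    rw [NNReal.smul_def, Real.coe_toNNReal _ (pow_nonneg (le_of_lt hx) _), smul_eq_mul]
  · exact (measurable_subtype_coe.pow_const _).real_toNNReal

/-- the point `(z,t)`. -/
def joinPt {m : ℕ} (z : EuclideanSpace ℝ (Fin m)) (t : ℝ) : EuclideanSpace ℝ (Fin (m+1)) :=
  WithLp.toLp 2 (Fin.snoc (α := fun _ => ℝ) (WithLp.ofLp z) t)

@[simp] lemma joinPt_last {m : ℕ} (z : EuclideanSpace ℝ (Fin m)) (t : ℝ) :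
    joinPt z t (Fin.last m) = t := by simp [joinPt]

@[simp] lemma joinPt_castSucc {m : ℕ} (z : EuclideanSpace ℝ (Fin m)) (t : ℝ) (i : Fin m) :
    joinPt z t i.castSucc = z i := by simp [joinPt]

lemma joinPt_norm_sq {m : ℕ} (z : EuclideanSpace ℝ (Fin m)) (t : ℝ) :
    ‖joinPt z t‖ ^ 2 = ‖z‖ ^ 2 + t ^ 2 := by
  rw [EuclideanSpace.real_norm_sq_eq, EuclideanSpace.real_norm_sq_eq, Fin.sum_univ_castSucc]
  simp

lemma joinPt_cont {m : ℕ} : Continuous (fun q : EuclideanSpace ℝ (Fin m) × ℝ => joinPt q.1 q.2) := by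
  unfold joinPt
  apply (PiLp.continuous_toLp 2 _).comp
  apply continuous_pi
  intro i
  refine Fin.lastCases ?_ (fun j => ?_) i
  · simpa using continuous_snd
  · simp only [Fin.snoc_castSucc]; fun_prop

lemma joinPt_mp {m : ℕ} : MeasurePreserving
    (fun q : EuclideanSpace ℝ (Fin m) × ℝ => joinPt q.1 q.2) (volume.prod volume) volume := by
  have h1 := (volume_preserving_piFinSuccAbove (fun _ : Fin (m + 1) => ℝ) (Fin.last m)).symm
  have h2 := PiLp.volume_preserving_toLp (Fin (m+1))
  have h3 := PiLp.volume_preserving_ofLp (Fin m)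
  have h4 : MeasurePreserving (fun q : EuclideanSpace ℝ (Fin m) × ℝ => (q.2, WithLp.ofLp q.1))
     (volume.prod volume) (volume.prod volume) :=
    ((MeasurePreserving.id volume).prod h3).comp (Measure.measurePreserving_swap (μ := (volume : Measure (EuclideanSpace ℝ (Fin m)))) (ν := (volume : Measure ℝ)))
  have h5 := h2.comp (h1.comp h4)
  have e : (fun q : EuclideanSpace ℝ (Fin m) × ℝ => joinPt q.1 q.2) =
      WithLp.toLp 2 ∘ ⇑(MeasurableEquiv.piFinSuccAbove (fun _ : Fin (m + 1) => ℝ) (Fin.last m)).symm ∘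
        fun q : EuclideanSpace ℝ (Fin m) × ℝ => (q.2, q.1.ofLp) := by
    funext q
    simp only [Function.comp, joinPt]
    congr 1
    simp [MeasurableEquiv.piFinSuccAbove, Fin.insertNthEquiv, Fin.insertNth_last']
  rw [e]
  exact h5

lemma joinPt_split {m : ℕ} (g : EuclideanSpace ℝ (Fin (m+1)) → ℝ) (hg : Integrable g) :
    ∫ y, g y = ∫ z : EuclideanSpace ℝ (Fin m), ∫ t : ℝ, g (joinPt z t) := by
  have h := joinPt_mp (m := m)
  rw [← h.map_eq, integral_map h.measurable.aemeasurable (by rw [h.map_eq]; exact hg.1)]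
  exact integral_prod (fun q : EuclideanSpace ℝ (Fin m) × ℝ => g (joinPt q.1 q.2))
    (h.integrable_comp_of_integrable hg)


/-- open upper half ball -/
def hbU (m : ℕ) (r : ℝ) : Set (EuclideanSpace ℝ (Fin (m+1))) :=
  {y | ‖y‖ < r ∧ 0 < y (Fin.last m)}

lemma integrable_of_bdd_ball {d : ℕ} (g : EuclideanSpace ℝ (Fin d) → ℝ) (hm : Measurable g) (r C : ℝ)
    (hC : ∀ y, |g y| ≤ C) (h0 : ∀ y, r ≤ ‖y‖ → g y = 0) : Integrable g := by
  have : IntegrableOn g (Metric.ball 0 r) :=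
    Measure.integrableOn_of_bounded (M := C) measure_ball_lt_top.ne hm.aestronglyMeasurable
      (Filter.Eventually.of_forall hC)
  apply this.integrable_of_forall_notMem_eq_zero
  intro y hy
  apply h0
  simpa using hy

lemma cutP_deriv_bdd : ∃ M, ∀ t, |deriv cutP t| ≤ M :=
  cutP_deriv_supp.exists_bound_of_continuous cutP_deriv_cont

lemma tendsto_v (v : ℝ) : Filter.Tendsto (fun k : ℕ => v / ((k:ℝ)+1)) Filter.atTop (nhds 0) :=
  tendsto_const_nhds.div_atTop (Filter.tendsto_atTop_add_const_right _ _ tendsto_natCast_atTop_atTop)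

lemma tendsto_K : Filter.Tendsto (fun k : ℕ => ((k:ℝ)+1)) Filter.atTop Filter.atTop :=
  Filter.tendsto_atTop_add_const_right _ _ tendsto_natCast_atTop_atTop

lemma cutP_eventually_one (a : ℕ → ℝ) (l : ℝ) (hl : 0 < l)
    (ha : Filter.Tendsto a Filter.atTop (nhds l)) :
    Filter.Tendsto (fun k : ℕ => cutP (((k:ℝ)+1) * a k)) Filter.atTop (nhds 1) := by
  have h := tendsto_K.atTop_mul_pos hl ha
  apply tendsto_const_nhds.congr'
  filter_upwards [h.eventually_ge_atTop 2] with k hk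
  rw [cutP_one hk]

lemma radial_limit (m : ℕ) (r : ℝ) (hr : 0 < r) (G : EuclideanSpace ℝ (Fin (m+1)) → ℝ)
    (hG : Measurable G) (C : ℝ) (hC : ∀ y, |G y| ≤ C) (h0 : ∀ y, y ∉ hbU m r → G y = 0)
    (l : Metric.sphere (0 : EuclideanSpace ℝ (Fin (m+1))) 1 → ℝ)
    (hl : ∀ ω : Metric.sphere (0 : EuclideanSpace ℝ (Fin (m+1))) 1,
      0 < (ω : EuclideanSpace ℝ (Fin (m+1))) (Fin.last m) →
      Filter.Tendsto (fun s : ℝ => G (s • (ω : EuclideanSpace ℝ (Fin (m+1))))) (nhdsWithin r (Set.Iio r))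
        (nhds (l ω))) :
    Filter.Tendsto (fun k : ℕ => ∫ y, ((k:ℝ)+1) * deriv cutP (((k:ℝ)+1) * (r - ‖y‖)) *
        (cutP (((k:ℝ)+1) * y (Fin.last m)) * G y)) Filter.atTop
      (nhds (r ^ m * ∫ ω in {ω : Metric.sphere (0 : EuclideanSpace ℝ (Fin (m+1))) 1 |
            0 < (ω : EuclideanSpace ℝ (Fin (m+1))) (Fin.last m)}, l ω
            ∂((volume : Measure (EuclideanSpace ℝ (Fin (m+1)))).toSphere))) := by
  have hC0 : 0 ≤ C := (abs_nonneg _).trans (hC 0)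
  obtain ⟨M, hM⟩ := cutP_deriv_bdd
  have hM0 : 0 ≤ M := (abs_nonneg _).trans (hM 0)
  set H : ℕ → Metric.sphere (0 : EuclideanSpace ℝ (Fin (m+1))) 1 → ℝ → ℝ := fun k ω t =>
    (Set.Ioi (0:ℝ)).indicator (fun s => s ^ m * (cutP (((k:ℝ)+1) * (s * (ω : EuclideanSpace ℝ (Fin (m+1))) (Fin.last m)))
      * G (s • (ω : EuclideanSpace ℝ (Fin (m+1)))))) (r - t) with hH
  have hωn : ∀ ω : Metric.sphere (0 : EuclideanSpace ℝ (Fin (m+1))) 1,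
      ‖(ω : EuclideanSpace ℝ (Fin (m+1)))‖ = 1 := fun ω => by simp
  have hHC : ∀ k ω t, |H k ω t| ≤ r ^ m * C := by
    intro k ω t
    simp only [hH, Set.indicator]
    split_ifs with h
    · rw [Set.mem_Ioi] at h
      by_cases h2 : r - t < r
      · rw [abs_mul, abs_mul, abs_of_pos (pow_pos h m)]
        have := mul_le_mul (cutP_abs (((k:ℝ)+1) * ((r-t) * (ω : EuclideanSpace ℝ (Fin (m+1))) (Fin.last m))))
          (hC ((r-t) • (ω : EuclideanSpace ℝ (Fin (m+1))))) (abs_nonneg _) zero_le_one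
        rw [one_mul] at this
        exact mul_le_mul (pow_le_pow_left₀ h.le h2.le m) this (by positivity) (by positivity)
      · rw [h0]
        · simp; positivity
        · intro hc
          have := hc.1
          rw [norm_smul, hωn, Real.norm_eq_abs, abs_of_pos h, mul_one] at this
          exact h2 this
    · simp; positivity
  have hHm2 : ∀ k, Measurable (fun q : Metric.sphere (0 : EuclideanSpace ℝ (Fin (m+1))) 1 × ℝ => H k q.1 q.2) := by
    intro k
    have : (fun q : Metric.sphere (0 : EuclideanSpace ℝ (Fin (m+1))) 1 × ℝ => H k q.1 q.2) =
      {q : Metric.sphere (0 : EuclideanSpace ℝ (Fin (m+1))) 1 × ℝ | 0 < r - q.2}.indicator (fun q =>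
        (r - q.2) ^ m * (cutP (((k:ℝ)+1) * ((r - q.2) * (q.1 : EuclideanSpace ℝ (Fin (m+1))) (Fin.last m)))
      * G ((r - q.2) • (q.1 : EuclideanSpace ℝ (Fin (m+1)))))) := by
      ext q; simp [hH, Set.indicator]
    rw [this]
    apply Measurable.indicator
    · apply Measurable.mul (by fun_prop)
      apply Measurable.mul
      · apply cutP_cont.measurable.comp
        fun_prop
      · apply hG.comp
        fun_prop
    · exact measurableSet_lt measurable_const (by fun_prop)
  have hint : ∀ k : ℕ, Integrable (fun y : EuclideanSpace ℝ (Fin (m+1)) => ((k:ℝ)+1) * deriv cutP (((k:ℝ)+1) * (r - ‖y‖)) *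
        (cutP (((k:ℝ)+1) * y (Fin.last m)) * G y)) := by
    intro k
    apply integrable_of_bdd_ball _ _ r (((k:ℝ)+1) * M * (1 * C))
    · intro y
      rw [abs_mul, abs_mul, abs_mul, abs_of_pos (by positivity : (0:ℝ) < (k:ℝ)+1)]
      gcongr ?_ * ?_ * (?_ * ?_)
      · exact hM _
      · exact cutP_abs _
      · exact hC _
    · intro y hy
      rw [h0 y (fun h => absurd h.1 (not_lt.2 hy))]; simp
    · have := cutP_deriv_cont.measurable
      have := cutP_cont.measurable
      fun_prop
  have e : ∀ k : ℕ, ∫ y : EuclideanSpace ℝ (Fin (m+1)), ((k:ℝ)+1) * deriv cutP (((k:ℝ)+1) * (r - ‖y‖)) *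
        (cutP (((k:ℝ)+1) * y (Fin.last m)) * G y)
      = ∫ ω, (∫ t, ((k:ℝ)+1) * deriv cutP (((k:ℝ)+1) * t) * H k ω t) ∂((volume : Measure (EuclideanSpace ℝ (Fin (m+1)))).toSphere) := by
    intro k
    rw [polar _ (hint k)]
    congr 1
    ext ω
    rw [← integral_sub_left_eq_self (fun t => ((k:ℝ)+1) * deriv cutP (((k:ℝ)+1) * t) * H k ω t) volume r,
      ← integral_indicator measurableSet_Ioi]
    congr 1
    ext s
    simp only [hH, Set.indicator, sub_sub_cancel]
    split_ifs with h
    · rw [norm_smul, hωn, Real.norm_eq_abs, abs_of_pos h, mul_one]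
      simp only [Nat.add_sub_cancel, PiLp.smul_apply, smul_eq_mul]
      ring
    · simp
  simp_rw [e]
  rw [← integral_indicator (measurableSet_lt measurable_const (by fun_prop)), ← integral_const_mul]
  apply tendsto_integral_of_dominated_convergence (fun _ => (∫ v, |deriv cutP v|) * (r ^ m * C))
  · intro k
    have : StronglyMeasurable (fun q : Metric.sphere (0 : EuclideanSpace ℝ (Fin (m+1))) 1 × ℝ =>
      ((k:ℝ)+1) * deriv cutP (((k:ℝ)+1) * q.2) * H k q.1 q.2) := by
      apply Measurable.stronglyMeasurable
      apply Measurable.mul _ (hHm2 k)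
      have := cutP_deriv_cont.measurable
      fun_prop
    exact this.integral_prod_right'.aestronglyMeasurable
  · exact integrable_const _
  · intro k
    filter_upwards with ω
    exact conc_bound _ (by positivity) _ _ (hHC k ω)
  · filter_upwards with ω
    apply conc_tendsto (fun k => H k ω) _ (r ^ m * C) (fun k => hHC k ω)
    · intro v hv
      simp only [Set.indicator, Set.mem_ofPred_eq]
      have ts : Filter.Tendsto (fun k : ℕ => r - v / ((k:ℝ)+1)) Filter.atTop (nhds r) := by
        simpa using (tendsto_v v).const_sub r
      split_ifs with h
      · have ts' : Filter.Tendsto (fun k : ℕ => r - v / ((k:ℝ)+1)) Filter.atTop (nhdsWithin r (Set.Iio r)) := by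
          apply tendsto_nhdsWithin_of_tendsto_nhds_of_eventually_within _ ts
          filter_upwards with k
          have : 0 < v / ((k:ℝ)+1) := by positivity
          simp only [Set.mem_Iio]; linarith
        have h1 := cutP_eventually_one _ _ (by positivity) (ts.mul_const ((ω : EuclideanSpace ℝ (Fin (m+1))) (Fin.last m)))
        have h2 := (hl ω h).comp ts'
        have h3 := (ts.pow m).mul (h1.mul h2)
        rw [one_mul] at h3
        apply h3.congr'
        filter_upwards [ts.eventually (lt_mem_nhds hr)] with k hk
        simp only [hH, Set.indicator, Set.mem_Ioi, hk, if_true, Function.comp]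
      · apply tendsto_const_nhds.congr
        intro k
        simp only [hH, Set.indicator]
        split_ifs with h3
        · rw [h0]
          · simp
          · intro hc
            apply h
            have := hc.2
            simp only [PiLp.smul_apply, smul_eq_mul] at this
            exact pos_of_mul_pos_right this (le_of_lt h3) 
        · simp
    · intro k
      exact (hHm2 k).comp measurable_prodMk_left

lemma flat_limit (m : ℕ) (r : ℝ) (hr : 0 < r) (G : EuclideanSpace ℝ (Fin (m+1)) → ℝ)
    (hG : Measurable G) (C : ℝ) (hC : ∀ y, |G y| ≤ C) (h0 : ∀ y, y ∉ hbU m r → G y = 0)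
    (l : EuclideanSpace ℝ (Fin m) → ℝ)
    (hl : ∀ z : EuclideanSpace ℝ (Fin m), ‖z‖ < r →
      Filter.Tendsto (fun t : ℝ => G (joinPt z t)) (nhdsWithin 0 (Set.Ioi 0)) (nhds (l z))) :
    Filter.Tendsto (fun k : ℕ => ∫ y : EuclideanSpace ℝ (Fin (m+1)), ((k:ℝ)+1) * deriv cutP (((k:ℝ)+1) * y (Fin.last m)) *
        (cutP (((k:ℝ)+1) * (r - ‖y‖)) * G y)) Filter.atTop
      (nhds (∫ z in Metric.ball (0 : EuclideanSpace ℝ (Fin m)) r, l z)) := by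
  have hC0 : 0 ≤ C := (abs_nonneg _).trans (hC 0)
  obtain ⟨M, hM⟩ := cutP_deriv_bdd
  have hM0 : 0 ≤ M := (abs_nonneg _).trans (hM 0)
  have hle : ∀ (z : EuclideanSpace ℝ (Fin m)) (t : ℝ), ‖z‖ ≤ ‖joinPt z t‖ := by
    intro z t
    have := joinPt_norm_sq z t
    apply le_of_sq_le_sq _ (norm_nonneg _)
    nlinarith [sq_nonneg t]
  set H : ℕ → EuclideanSpace ℝ (Fin m) → ℝ → ℝ := fun k z t =>
    cutP (((k:ℝ)+1) * (r - ‖joinPt z t‖)) * G (joinPt z t) with hH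
  clear_value H
  have hHC : ∀ k z t, |H k z t| ≤ C := by
    intro k z t
    simp only [hH]
    rw [abs_mul]
    have := mul_le_mul (cutP_abs (((k:ℝ)+1) * (r - ‖joinPt z t‖)))
          (hC (joinPt z t)) (abs_nonneg _) zero_le_one
    rwa [one_mul] at this
  have hH0 : ∀ k z t, r ≤ ‖z‖ → H k z t = 0 := by
    intro k z t hz
    simp only [hH]
    rw [h0, mul_zero]
    intro hc
    linarith [hc.1, hle z t]
  have hHm2 : ∀ k, Measurable (fun q : EuclideanSpace ℝ (Fin m) × ℝ => H k q.1 q.2) := by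
    intro k
    have hj := (joinPt_cont (m := m)).measurable
    have := cutP_cont.measurable
    have h1 : Measurable (fun q : EuclideanSpace ℝ (Fin m) × ℝ =>
        cutP (((k:ℝ)+1) * (r - ‖joinPt q.1 q.2‖))) := by
      have h2 : Measurable (fun q : EuclideanSpace ℝ (Fin m) × ℝ => ‖joinPt q.1 q.2‖) := hj.norm
      fun_prop
    have h3 : Measurable (fun q : EuclideanSpace ℝ (Fin m) × ℝ => G (joinPt q.1 q.2)) := hG.comp hj
    simp only [hH]
    exact h1.mul h3
  have hHm1 : ∀ k z, Measurable (H k z) := by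
    intro k z
    have h1 : Measurable fun t : ℝ => (z, t) := by fun_prop
    have h2 := (hHm2 k).comp h1
    exact h2
  have hint : ∀ k : ℕ, Integrable (fun y : EuclideanSpace ℝ (Fin (m+1)) => ((k:ℝ)+1) * deriv cutP (((k:ℝ)+1) * y (Fin.last m)) *
        (cutP (((k:ℝ)+1) * (r - ‖y‖)) * G y)) := by
    intro k
    apply integrable_of_bdd_ball _ _ r (((k:ℝ)+1) * M * (1 * C))
    · intro y
      rw [abs_mul, abs_mul, abs_mul, abs_of_pos (by positivity : (0:ℝ) < (k:ℝ)+1)]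
      gcongr ?_ * ?_ * (?_ * ?_)
      · exact hM _
      · exact cutP_abs _
      · exact hC _
    · intro y hy
      rw [h0 y (fun h => absurd h.1 (not_lt.2 hy))]; simp
    · have := cutP_deriv_cont.measurable
      have := cutP_cont.measurable
      fun_prop
  have e : ∀ k : ℕ, ∫ y : EuclideanSpace ℝ (Fin (m+1)), ((k:ℝ)+1) * deriv cutP (((k:ℝ)+1) * y (Fin.last m)) *
        (cutP (((k:ℝ)+1) * (r - ‖y‖)) * G y)
      = ∫ z, (∫ t, ((k:ℝ)+1) * deriv cutP (((k:ℝ)+1) * t) * H k z t) := by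
    intro k
    rw [joinPt_split _ (hint k)]
    simp only [hH, joinPt_last]
  simp_rw [e]
  rw [← integral_indicator measurableSet_ball]
  apply tendsto_integral_of_dominated_convergence
    ((Metric.ball (0 : EuclideanSpace ℝ (Fin m)) r).indicator (fun _ => (∫ v, |deriv cutP v|) * C))
  · intro k
    have : StronglyMeasurable (fun q : EuclideanSpace ℝ (Fin m) × ℝ =>
      ((k:ℝ)+1) * deriv cutP (((k:ℝ)+1) * q.2) * H k q.1 q.2) := by
      apply Measurable.stronglyMeasurable
      apply Measurable.mul _ (hHm2 k)
      have := cutP_deriv_cont.measurable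
      fun_prop
    exact this.integral_prod_right'.aestronglyMeasurable
  · rw [integrable_indicator_iff measurableSet_ball]
    exact integrableOn_const measure_ball_lt_top.ne
  · intro k
    filter_upwards with z
    by_cases hz : z ∈ Metric.ball (0 : EuclideanSpace ℝ (Fin m)) r
    · rw [Set.indicator_of_mem hz]
      exact conc_bound _ (by positivity) _ _ (hHC k z)
    · rw [Set.indicator_of_notMem hz]
      have : r ≤ ‖z‖ := by simpa using hz
      simp [hH0 k z _ this]
  · filter_upwards with z
    by_cases hz : z ∈ Metric.ball (0 : EuclideanSpace ℝ (Fin m)) r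
    · rw [Set.indicator_of_mem hz]
      have hz' : ‖z‖ < r := by simpa using hz
      refine conc_tendsto (fun k => H k z) (fun k => hHm1 k z) C (fun k => hHC k z) (l z) ?_
      · intro v hv
        have ts' : Filter.Tendsto (fun k : ℕ => v / ((k:ℝ)+1)) Filter.atTop (nhdsWithin 0 (Set.Ioi 0)) := by
          apply tendsto_nhdsWithin_of_tendsto_nhds_of_eventually_within _ (tendsto_v v)
          filter_upwards with k
          have : 0 < v / ((k:ℝ)+1) := by positivity
          exact this
        have hc : Continuous (fun t => r - ‖joinPt z t‖) :=
          continuous_const.sub (joinPt_cont.comp (by fun_prop : Continuous fun t : ℝ => (z, t))).norm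
        have h00 : ‖joinPt z 0‖ = ‖z‖ := by
          have := joinPt_norm_sq z 0
          rw [← sq_eq_sq₀ (norm_nonneg _) (norm_nonneg _)]; simpa using this
        have ha := (hc.tendsto 0).comp (tendsto_v v)
        have h1 := cutP_eventually_one _ _ (by rw [h00]; linarith) ha
        have h2 := (hl z hz').comp ts'
        have h3 := h1.mul h2
        rw [one_mul] at h3
        refine h3.congr (fun k => ?_)
        simp only [hH, Function.comp_apply]
    · rw [Set.indicator_of_notMem hz]
      have : r ≤ ‖z‖ := by simpa using hz
      simp [hH0 _ z _ this]


/-- closed upper half ball -/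
def hbS (m : ℕ) (r : ℝ) : Set (EuclideanSpace ℝ (Fin (m+1))) :=
  {y | ‖y‖ ≤ r ∧ 0 ≤ y (Fin.last m)}

lemma hbU_open (m : ℕ) (r : ℝ) : IsOpen (hbU m r) := by
  apply IsOpen.inter
  · exact isOpen_lt continuous_norm continuous_const
  · exact isOpen_lt continuous_const (by fun_prop : Continuous fun y : EuclideanSpace ℝ (Fin (m+1)) => y (Fin.last m))

lemma hbU_sub (m : ℕ) (r : ℝ) : hbU m r ⊆ hbS m r := fun _ hy => ⟨hy.1.le, hy.2.le⟩

lemma hbS_compact (m : ℕ) (r : ℝ) : IsCompact (hbS m r) := by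
  have h1 : IsClosed (hbS m r) := by
    apply IsClosed.inter
    · exact isClosed_le continuous_norm continuous_const
    · exact isClosed_le continuous_const (by fun_prop : Continuous fun y : EuclideanSpace ℝ (Fin (m+1)) => y (Fin.last m))
  apply (isCompact_closedBall (0 : EuclideanSpace ℝ (Fin (m+1))) r).of_isClosed_subset h1
  intro y hy
  simpa using hy.1

lemma hbS_bdd (m : ℕ) (r : ℝ) (g : EuclideanSpace ℝ (Fin (m+1)) → ℝ) (hg : ContinuousOn g (hbS m r)) :
    ∃ C, 0 ≤ C ∧ ∀ y ∈ hbS m r, |g y| ≤ C := by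
  obtain ⟨C, hC⟩ := (hbS_compact m r).exists_bound_of_continuousOn hg
  exact ⟨max C 0, le_max_right _ _, fun y hy => (hC y hy).trans (le_max_left _ _)⟩

lemma indicator_meas {d : ℕ} (U : Set (EuclideanSpace ℝ (Fin d))) (hU : IsOpen U)
    (g : EuclideanSpace ℝ (Fin d) → ℝ) (hg : ContinuousOn g U) : Measurable (U.indicator g) := by
  classical
  rw [← Set.piecewise_eq_indicator]
  exact hg.measurable_piecewise continuousOn_const hU.measurableSet

lemma hasFDerivAt_norm_eu {d : ℕ} (y : EuclideanSpace ℝ (Fin d)) (hy : y ≠ 0) :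
    HasFDerivAt (fun y : EuclideanSpace ℝ (Fin d) => ‖y‖) ((‖y‖⁻¹) • innerSL ℝ y) y := by
  have h := (hasStrictFDerivAt_norm_sq y).hasFDerivAt.sqrt (by positivity)
  have hn : ‖y‖ ≠ 0 := norm_ne_zero_iff.2 hy
  simp only [Real.sqrt_sq (norm_nonneg _)] at h
  have e : (1 / (2 * ‖y‖)) • (2 : ℕ) • (innerSL ℝ) y = (‖y‖⁻¹) • innerSL ℝ y := by
    rw [← Nat.cast_smul_eq_nsmul ℝ, smul_smul]
    congr 1
    push_cast
    field_simp
  rw [← e]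
  exact h

/-- combined cutoff -/
def cutC (m : ℕ) (r K : ℝ) (y : EuclideanSpace ℝ (Fin (m+1))) : ℝ :=
  cutP (K * (r - ‖y‖)) * cutP (K * y (Fin.last m))

lemma hbU_ne {m : ℕ} {r : ℝ} {y : EuclideanSpace ℝ (Fin (m+1))} (hy : y ∈ hbU m r) : y ≠ 0 := by
  rintro rfl
  have := hy.2
  simp at this

lemma cutC_contDiffAt {m : ℕ} {r K : ℝ} {y : EuclideanSpace ℝ (Fin (m+1))} (hy : y ∈ hbU m r) :
    ContDiffAt ℝ 1 (cutC m r K) y := by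
  have h1 : ContDiffAt ℝ 1 (fun y : EuclideanSpace ℝ (Fin (m+1)) => ‖y‖) y := contDiffAt_norm ℝ (hbU_ne hy)
  have h2 : ContDiffAt ℝ 1 (fun y : EuclideanSpace ℝ (Fin (m+1)) => y (Fin.last m)) y := by fun_prop
  unfold cutC
  exact (cutP_contDiff.contDiffAt.comp y (contDiffAt_const.mul (contDiffAt_const.sub h1))).mul
    (cutP_contDiff.contDiffAt.comp y (contDiffAt_const.mul h2))

lemma cutC_fderiv {m : ℕ} {r K : ℝ} {y : EuclideanSpace ℝ (Fin (m+1))} (hy : y ∈ hbU m r) (i : Fin (m+1)) :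
    fderiv ℝ (cutC m r K) y (EuclideanSpace.single i 1)
      = - (K * deriv cutP (K * (r - ‖y‖)) * (cutP (K * y (Fin.last m)) * (y i / ‖y‖)))
        + K * deriv cutP (K * y (Fin.last m)) * (cutP (K * (r - ‖y‖)) * (if i = Fin.last m then 1 else 0)) := by
  have h1 := hasFDerivAt_norm_eu y (hbU_ne hy)
  have h2 : HasFDerivAt (fun y : EuclideanSpace ℝ (Fin (m+1)) => y (Fin.last m))
      (EuclideanSpace.proj (Fin.last m) : EuclideanSpace ℝ (Fin (m+1)) →L[ℝ] ℝ) y :=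
    (EuclideanSpace.proj (Fin.last m) : EuclideanSpace ℝ (Fin (m+1)) →L[ℝ] ℝ).hasFDerivAt
  have h3 := (cutP_hasDeriv (K * (r - ‖y‖))).comp_hasFDerivAt y ((h1.const_sub r).const_mul K)
  have h4 := (cutP_hasDeriv (K * y (Fin.last m))).comp_hasFDerivAt y (h2.const_mul K)
  have h5 : HasFDerivAt (cutC m r K) _ y := h3.mul h4
  rw [h5.fderiv]
  simp [real_inner_comm, EuclideanSpace.inner_single_left, EuclideanSpace.inner_single_right, Function.comp]
  simp only [Pi.single_apply, eq_comm (a := Fin.last m)]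
  split_ifs <;> ring

lemma cutC_eventually_zero {m : ℕ} {r K : ℝ} (hK : 0 < K) {y : EuclideanSpace ℝ (Fin (m+1))} (hy : y ∉ hbU m r) :
    ∀ᶠ x in nhds y, cutC m r K x = 0 := by
  have h : r ≤ ‖y‖ ∨ y (Fin.last m) ≤ 0 := by
    by_contra hc
    push Not at hc
    exact hy hc
  rcases h with h | h
  · have : Continuous (fun x : EuclideanSpace ℝ (Fin (m+1)) => K * (r - ‖x‖)) := by fun_prop
    have h2 := this.tendsto y
    have h3 : K * (r - ‖y‖) < 1 := by nlinarith
    filter_upwards [h2.eventually (gt_mem_nhds h3)] with x hx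
    rw [cutC, cutP_zero (le_of_lt hx), zero_mul]
  · have : Continuous (fun x : EuclideanSpace ℝ (Fin (m+1)) => K * x (Fin.last m)) := by fun_prop
    have h2 := this.tendsto y
    have h3 : K * y (Fin.last m) < 1 := by nlinarith
    filter_upwards [h2.eventually (gt_mem_nhds h3)] with x hx
    rw [cutC, cutP_zero (le_of_lt hx), mul_zero]

lemma integral_fderiv_zero {d : ℕ} (g : EuclideanSpace ℝ (Fin d) → ℝ) (hg : ContDiff ℝ 1 g)
    (hs : HasCompactSupport g) (v : EuclideanSpace ℝ (Fin d)) :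
    Integrable (fun y => fderiv ℝ g y v) ∧ ∫ y, fderiv ℝ g y v = 0 := by
  have h1 : Integrable (fun y => fderiv ℝ g y v) := by
    apply Continuous.integrable_of_hasCompactSupport
    · exact (hg.continuous_fderiv (by norm_num)).clm_apply continuous_const
    · exact hs.fderiv_apply ℝ v
  refine ⟨h1, ?_⟩
  have h2 : Integrable g := hg.continuous.integrable_of_hasCompactSupport hs
  have := integral_mul_fderiv_eq_neg_fderiv_mul_of_integrable (μ := volume) (𝕜 := ℝ) (f := fun _ : EuclideanSpace ℝ (Fin d) => (1:ℝ))
    (g := g) (v := v) (by simp) (by simpa using h1) (by simpa using h2) (by simp)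
    (fun x _ => hg.differentiable (by norm_num) x)
  simpa using this

lemma weak_div (m : ℕ) (r : ℝ) (F : Fin (m+1) → EuclideanSpace ℝ (Fin (m+1)) → ℝ)
    (hFc : ∀ i, ContinuousOn (F i) (hbS m r))
    (hFd : ∀ i, ContDiffOn ℝ 1 (F i) (hbU m r))
    (hdiv : ∀ y ∈ hbU m r, ∑ i, fderiv ℝ (F i) y (EuclideanSpace.single i 1) = 0)
    (K : ℝ) (hK : 0 < K) :
    ∫ y : EuclideanSpace ℝ (Fin (m+1)), K * deriv cutP (K * (r - ‖y‖)) *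
        (cutP (K * y (Fin.last m)) * (hbU m r).indicator (fun y => ∑ i, F i y * (y i / ‖y‖)) y)
    = ∫ y : EuclideanSpace ℝ (Fin (m+1)), K * deriv cutP (K * y (Fin.last m)) *
        (cutP (K * (r - ‖y‖)) * (hbU m r).indicator (F (Fin.last m)) y) := by
  have hΦ : ∀ i, ContDiff ℝ 1 (fun y => cutC m r K y * F i y) := by
    intro i
    rw [contDiff_iff_contDiffAt]
    intro y
    by_cases hy : y ∈ hbU m r
    · exact (cutC_contDiffAt hy).mul ((hFd i).contDiffAt ((hbU_open m r).mem_nhds hy))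
    · have : (fun y => cutC m r K y * F i y) =ᶠ[nhds y] fun _ => 0 := by
        filter_upwards [cutC_eventually_zero hK hy] with x hx
        rw [hx, zero_mul]
      exact contDiffAt_const.congr_of_eventuallyEq this
  have hs : ∀ i, HasCompactSupport (fun y => cutC m r K y * F i y) := by
    intro i
    apply HasCompactSupport.of_support_subset_isCompact (isCompact_closedBall (0 : EuclideanSpace ℝ (Fin (m+1))) r)
    intro y hy
    by_contra hc
    apply hy
    have : y ∉ hbU m r := fun h => hc (by simpa using h.1.le)
    simp only [(cutC_eventually_zero hK this).self_of_nhds, zero_mul]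
  have h0 : ∫ y, ∑ i, fderiv ℝ (fun y => cutC m r K y * F i y) y (EuclideanSpace.single i 1) = 0 := by
    rw [integral_finsetSum]
    · exact Finset.sum_eq_zero fun i _ => (integral_fderiv_zero _ (hΦ i) (hs i) _).2
    · exact fun i _ => (integral_fderiv_zero _ (hΦ i) (hs i) _).1
  have hpt : ∀ y, ∑ i, fderiv ℝ (fun y => cutC m r K y * F i y) y (EuclideanSpace.single i 1)
      = K * deriv cutP (K * y (Fin.last m)) *
        (cutP (K * (r - ‖y‖)) * (hbU m r).indicator (F (Fin.last m)) y)
       - K * deriv cutP (K * (r - ‖y‖)) *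
        (cutP (K * y (Fin.last m)) * (hbU m r).indicator (fun y => ∑ i, F i y * (y i / ‖y‖)) y) := by
    intro y
    by_cases hy : y ∈ hbU m r
    · rw [Set.indicator_of_mem hy, Set.indicator_of_mem hy]
      have e : ∀ i, fderiv ℝ (fun y => cutC m r K y * F i y) y (EuclideanSpace.single i 1)
          = cutC m r K y * fderiv ℝ (F i) y (EuclideanSpace.single i 1)
            + F i y * fderiv ℝ (cutC m r K) y (EuclideanSpace.single i 1) := by
        intro i
        rw [fderiv_fun_mul ((cutC_contDiffAt hy).differentiableAt (by norm_num))
          (((hFd i).contDiffAt ((hbU_open m r).mem_nhds hy)).differentiableAt (by norm_num))]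
        simp
      simp_rw [e]
      rw [Finset.sum_add_distrib, ← Finset.mul_sum, hdiv y hy, mul_zero, zero_add]
      simp_rw [cutC_fderiv hy]
      simp only [mul_add, Finset.sum_add_distrib]
      simp only [mul_ite, mul_one, mul_zero, Finset.sum_ite_eq', Finset.sum_ite_eq, Finset.mem_univ, if_true]
      simp only [Finset.mul_sum]
      rw [add_comm, sub_eq_add_neg _ (Finset.sum _ _), ← Finset.sum_neg_distrib]
      congr 1
      · ring
      · exact Finset.sum_congr rfl fun i _ => by ring
    · rw [Set.indicator_of_notMem hy, Set.indicator_of_notMem hy]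
      simp only [mul_zero, sub_zero]
      apply Finset.sum_eq_zero
      intro i _
      have : (fun y => cutC m r K y * F i y) =ᶠ[nhds y] fun _ => 0 := by
        filter_upwards [cutC_eventually_zero hK hy] with x hx
        rw [hx, zero_mul]
      rw [this.fderiv_eq]; simp
  simp_rw [hpt] at h0
  obtain ⟨M, hM⟩ := cutP_deriv_bdd
  have hM0 : 0 ≤ M := (abs_nonneg _).trans (hM 0)
  have key : ∀ (G : EuclideanSpace ℝ (Fin (m+1)) → ℝ), ContinuousOn G (hbU m r) →
     (∃ C, 0 ≤ C ∧ ∀ y ∈ hbU m r, |G y| ≤ C) → ∀ (a b : EuclideanSpace ℝ (Fin (m+1)) → ℝ), Continuous a → Continuous b →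
     Integrable (fun y => K * deriv cutP (a y) * (cutP (b y) * (hbU m r).indicator G y)) := by
    rintro G hG ⟨C, hC0, hC⟩ a b ha hb
    have hm := indicator_meas _ (hbU_open m r) G hG
    apply integrable_of_bdd_ball _ _ r (K * M * (1 * C))
    · intro y
      rw [abs_mul, abs_mul, abs_mul, abs_of_pos hK]
      gcongr ?_ * ?_ * (?_ * ?_)
      · exact hM _
      · exact cutP_abs _
      · by_cases hy : y ∈ hbU m r
        · rw [Set.indicator_of_mem hy]; exact hC y hy
        · rw [Set.indicator_of_notMem hy]; simpa using hC0
    · intro y hy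
      rw [Set.indicator_of_notMem (fun h => absurd h.1 (not_lt.2 hy))]; simp
    · have h1 : Measurable fun y => deriv cutP (a y) := (cutP_deriv_cont.comp ha).measurable
      have h2 : Measurable fun y => cutP (b y) := (cutP_cont.comp hb).measurable
      fun_prop
  rw [integral_sub, sub_eq_zero] at h0
  · exact h0.symm
  · apply key
    · exact (hFc _).mono (hbU_sub m r)
    · obtain ⟨C, h1, h2⟩ := hbS_bdd m r _ (hFc (Fin.last m))
      exact ⟨C, h1, fun y hy => h2 y (hbU_sub m r hy)⟩
    · fun_prop
    · fun_prop
  · apply key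
    · apply continuousOn_finsetSum
      intro i _
      apply ((hFc _).mono (hbU_sub m r)).mul
      apply ContinuousOn.div (by fun_prop) (by fun_prop)
      intro y hy
      exact norm_ne_zero_iff.2 (hbU_ne hy)
    · choose C h1 h2 using fun i => hbS_bdd m r _ (hFc i)
      refine ⟨∑ i, C i, Finset.sum_nonneg fun i _ => h1 i, fun y hy => ?_⟩
      refine (Finset.abs_sum_le_sum_abs _ _).trans (Finset.sum_le_sum fun i _ => ?_)
      rw [abs_mul, ← mul_one (C i)]
      refine mul_le_mul (h2 i y (hbU_sub m r hy)) ?_ (abs_nonneg _) (h1 i)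
      rw [abs_div, abs_norm]
      exact div_le_one_of_le₀ (PiLp.norm_apply_le y i) (norm_nonneg _)
    · fun_prop
    · fun_prop

lemma div_thm (m : ℕ) (r : ℝ) (hr : 0 < r) (F : Fin (m+1) → EuclideanSpace ℝ (Fin (m+1)) → ℝ)
    (hFc : ∀ i, ContinuousOn (F i) (hbS m r))
    (hFd : ∀ i, ContDiffOn ℝ 1 (F i) (hbU m r))
    (hdiv : ∀ y ∈ hbU m r, ∑ i, fderiv ℝ (F i) y (EuclideanSpace.single i 1) = 0) :
    r ^ m * ∫ ω in {ω : Metric.sphere (0 : EuclideanSpace ℝ (Fin (m+1))) 1 |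
            0 < (ω : EuclideanSpace ℝ (Fin (m+1))) (Fin.last m)},
            (∑ i, F i (r • (ω : EuclideanSpace ℝ (Fin (m+1)))) * (ω : EuclideanSpace ℝ (Fin (m+1))) i)
            ∂((volume : Measure (EuclideanSpace ℝ (Fin (m+1)))).toSphere)
      = ∫ z in Metric.ball (0 : EuclideanSpace ℝ (Fin m)) r, F (Fin.last m) (joinPt z 0) := by
  have hωn : ∀ ω : Metric.sphere (0 : EuclideanSpace ℝ (Fin (m+1))) 1,
      ‖(ω : EuclideanSpace ℝ (Fin (m+1)))‖ = 1 := fun ω => by simp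
  choose C h1 h2 using fun i => hbS_bdd m r _ (hFc i)
  have T1 := radial_limit m r hr ((hbU m r).indicator (fun y => ∑ i, F i y * (y i / ‖y‖)))
    (by
      apply indicator_meas _ (hbU_open m r)
      apply continuousOn_finsetSum
      intro i _
      apply ((hFc _).mono (hbU_sub m r)).mul
      apply ContinuousOn.div (by fun_prop) (by fun_prop)
      intro y hy
      exact norm_ne_zero_iff.2 (hbU_ne hy))
    (∑ i, C i)
    (by
      intro y
      by_cases hy : y ∈ hbU m r
      · rw [Set.indicator_of_mem hy]
        refine (Finset.abs_sum_le_sum_abs _ _).trans (Finset.sum_le_sum fun i _ => ?_)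
        rw [abs_mul, ← mul_one (C i)]
        refine mul_le_mul (h2 i y (hbU_sub m r hy)) ?_ (abs_nonneg _) (h1 i)
        rw [abs_div, abs_norm]
        exact div_le_one_of_le₀ (PiLp.norm_apply_le y i) (norm_nonneg _)
      · rw [Set.indicator_of_notMem hy]
        simpa using Finset.sum_nonneg fun i _ => h1 i)
    (fun y hy => Set.indicator_of_notMem hy _)
    (fun ω => ∑ i, F i (r • (ω : EuclideanSpace ℝ (Fin (m+1)))) * (ω : EuclideanSpace ℝ (Fin (m+1))) i)
    (by
      intro ω hω
      have hev : ∀ᶠ s in nhdsWithin r (Set.Iio r), 0 < s ∧ s < r := by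
        filter_upwards [self_mem_nhdsWithin, mem_nhdsWithin_of_mem_nhds (lt_mem_nhds hr)] with s h1 h2
        exact ⟨h2, h1⟩
      have hU : ∀ s : ℝ, 0 < s → s < r → s • (ω : EuclideanSpace ℝ (Fin (m+1))) ∈ hbU m r := by
        intro s hs hs'
        refine ⟨?_, ?_⟩
        · rw [norm_smul, hωn, Real.norm_eq_abs, abs_of_pos hs]; linarith
        · simp only [PiLp.smul_apply, smul_eq_mul]; positivity
      have hrS : r • (ω : EuclideanSpace ℝ (Fin (m+1))) ∈ hbS m r := by
        refine ⟨?_, ?_⟩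
        · rw [norm_smul, hωn, Real.norm_eq_abs, abs_of_pos hr]; linarith
        · simp only [PiLp.smul_apply, smul_eq_mul]; positivity
      have ht : Filter.Tendsto (fun s : ℝ => s • (ω : EuclideanSpace ℝ (Fin (m+1))))
          (nhdsWithin r (Set.Iio r)) (nhdsWithin (r • (ω : EuclideanSpace ℝ (Fin (m+1)))) (hbS m r)) := by
        apply tendsto_nhdsWithin_of_tendsto_nhds_of_eventually_within
        · have : Continuous (fun s : ℝ => s • (ω : EuclideanSpace ℝ (Fin (m+1)))) := by fun_prop
          exact (this.tendsto r).mono_left nhdsWithin_le_nhds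
        · filter_upwards [hev] with s hs using hbU_sub m r (hU s hs.1 hs.2)
      have h3 : Filter.Tendsto (fun s : ℝ => ∑ i, F i (s • (ω : EuclideanSpace ℝ (Fin (m+1)))) * (ω : EuclideanSpace ℝ (Fin (m+1))) i)
          (nhdsWithin r (Set.Iio r)) (nhds (∑ i, F i (r • (ω : EuclideanSpace ℝ (Fin (m+1)))) * (ω : EuclideanSpace ℝ (Fin (m+1))) i)) := by
        apply tendsto_finsetSum
        intro i _
        exact (Filter.Tendsto.comp (hFc i _ hrS) ht).mul_const _
      apply h3.congr'
      filter_upwards [hev] with s hs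
      rw [Set.indicator_of_mem (hU s hs.1 hs.2)]
      apply Finset.sum_congr rfl
      intro i _
      rw [norm_smul, hωn, Real.norm_eq_abs, abs_of_pos hs.1]
      simp only [PiLp.smul_apply, smul_eq_mul]
      have := hs.1.ne'
      field_simp)
  have T2 := flat_limit m r hr ((hbU m r).indicator (F (Fin.last m)))
    (indicator_meas _ (hbU_open m r) _ ((hFc _).mono (hbU_sub m r))) (C (Fin.last m))
    (by
      intro y
      by_cases hy : y ∈ hbU m r
      · rw [Set.indicator_of_mem hy]
        exact h2 _ y (hbU_sub m r hy)
      · rw [Set.indicator_of_notMem hy]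
        simpa using h1 _)
    (fun y hy => Set.indicator_of_notMem hy _)
    (fun z => F (Fin.last m) (joinPt z 0))
    (by
      intro z hz
      have hc : Continuous (fun t : ℝ => joinPt z t) := 
        joinPt_cont.comp (by fun_prop : Continuous fun t : ℝ => (z, t))
      have h00 : ‖joinPt z 0‖ = ‖z‖ := by
        have := joinPt_norm_sq z 0
        rw [← sq_eq_sq₀ (norm_nonneg _) (norm_nonneg _)]; simpa using this
      have hev : ∀ᶠ t in nhdsWithin 0 (Set.Ioi 0), joinPt z t ∈ hbU m r := by
        have := (hc.norm.tendsto 0).eventually (gt_mem_nhds (h00.trans_lt hz))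
        filter_upwards [self_mem_nhdsWithin, mem_nhdsWithin_of_mem_nhds this] with t h1 h2
        exact ⟨h2, by simpa using h1⟩
      have ht : Filter.Tendsto (fun t : ℝ => joinPt z t)
          (nhdsWithin 0 (Set.Ioi 0)) (nhdsWithin (joinPt z 0) (hbS m r)) := by
        apply tendsto_nhdsWithin_of_tendsto_nhds_of_eventually_within
        · exact (hc.tendsto 0).mono_left nhdsWithin_le_nhds
        · filter_upwards [hev] with s hs using hbU_sub m r hs
      have hS : joinPt z 0 ∈ hbS m r := ⟨by linarith, by simp⟩
      apply (Filter.Tendsto.comp (hFc (Fin.last m) _ hS) ht).congr'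
      filter_upwards [hev] with t ht
      rw [Set.indicator_of_mem ht]; rfl)
  refine tendsto_nhds_unique T1 (T2.congr fun k => ?_)
  exact (weak_div m r F hFc hFd hdiv _ (by positivity)).symm


lemma flat_ftc (m : ℕ) (hm : 1 ≤ m) (r : ℝ) (hr : 0 < r) (g : EuclideanSpace ℝ (Fin m) → ℝ)
    (D : EuclideanSpace ℝ (Fin m) → EuclideanSpace ℝ (Fin m) →L[ℝ] ℝ)
    (hgc : ContinuousOn g (Metric.closedBall 0 r))
    (hd : ∀ z, ‖z‖ < r → HasFDerivAt g (D z) z)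
    (hDc : ContinuousOn (fun z => D z z) (Metric.closedBall 0 r)) :
    ∫ z in Metric.ball (0 : EuclideanSpace ℝ (Fin m)) r, ((m:ℝ) * g z + D z z)
      = r ^ m * ∫ ζ : Metric.sphere (0 : EuclideanSpace ℝ (Fin m)) 1,
          g (r • (ζ : EuclideanSpace ℝ (Fin m))) ∂((volume : Measure (EuclideanSpace ℝ (Fin m))).toSphere) := by
  haveI : Nonempty (Fin m) := ⟨⟨0, hm⟩⟩
  haveI : Nontrivial (EuclideanSpace ℝ (Fin m)) := inferInstance
  have hωn : ∀ ω : Metric.sphere (0 : EuclideanSpace ℝ (Fin m)) 1,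
      ‖(ω : EuclideanSpace ℝ (Fin m))‖ = 1 := fun ω => by simp
  have hc : ContinuousOn (fun z => (m:ℝ) * g z + D z z) (Metric.closedBall 0 r) :=
    (continuousOn_const.mul hgc).add hDc
  have hi : IntegrableOn (fun z => (m:ℝ) * g z + D z z) (Metric.ball 0 r) :=
    (hc.integrableOn_compact (isCompact_closedBall _ _)).mono_set Metric.ball_subset_closedBall
  rw [← integral_indicator measurableSet_ball, polar _ ((integrable_indicator_iff measurableSet_ball).2 hi),
    ← integral_const_mul]
  congr 1
  ext ζ
  set ω : EuclideanSpace ℝ (Fin m) := (ζ : EuclideanSpace ℝ (Fin m)) with hω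
  have hω1 : ‖ω‖ = 1 := hωn ζ
  have hmaps : Set.MapsTo (fun s : ℝ => s • ω) (Set.Icc 0 r) (Metric.closedBall 0 r) := by
    intro s hs
    simp only [mem_closedBall_zero_iff, norm_smul, hω1, mul_one, Real.norm_eq_abs, abs_of_nonneg hs.1]
    exact hs.2
  have hsm : ContinuousOn (fun s : ℝ => s • ω) (Set.Icc 0 r) := by fun_prop
  have h1 : ∫ s in Set.Ioi (0:ℝ), s ^ (m - 1) * (Metric.ball (0 : EuclideanSpace ℝ (Fin m)) r).indicator
        (fun z => (m:ℝ) * g z + D z z) (s • ω)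
      = ∫ s in Set.Ioo 0 r, s ^ (m - 1) * ((m:ℝ) * g (s • ω) + D (s • ω) (s • ω)) := by
    rw [← integral_indicator measurableSet_Ioi, ← integral_indicator measurableSet_Ioo]
    congr 1
    ext s
    by_cases hs : 0 < s
    · by_cases hs2 : s < r
      · have : s • ω ∈ Metric.ball (0 : EuclideanSpace ℝ (Fin m)) r := by
          simpa [norm_smul, hω1, abs_of_pos hs] using hs2
        rw [Set.indicator_of_mem (Set.mem_Ioi.2 hs), Set.indicator_of_mem this,
          Set.indicator_of_mem (Set.mem_Ioo.2 ⟨hs, hs2⟩)]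
      · have : s • ω ∉ Metric.ball (0 : EuclideanSpace ℝ (Fin m)) r := by
          simpa [norm_smul, hω1, abs_of_pos hs] using hs2
        rw [Set.indicator_of_mem (Set.mem_Ioi.2 hs), Set.indicator_of_notMem this,
          Set.indicator_of_notMem (fun h => hs2 h.2), mul_zero]
    · rw [Set.indicator_of_notMem (by simpa using hs), Set.indicator_of_notMem (fun h => hs h.1)]
  rw [h1, ← integral_Ioc_eq_integral_Ioo, ← intervalIntegral.integral_of_le hr.le]
  have hcont' : ContinuousOn (fun s : ℝ => s ^ (m - 1) * ((m:ℝ) * g (s • ω) + D (s • ω) (s • ω))) (Set.Icc 0 r) := by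
    have := hc.comp hsm hmaps
    apply ContinuousOn.mul (by fun_prop) this
  have hF := intervalIntegral.integral_eq_sub_of_hasDerivAt_of_le (f := fun s : ℝ => s ^ m * g (s • ω))
    (f' := fun s : ℝ => s ^ (m - 1) * ((m:ℝ) * g (s • ω) + D (s • ω) (s • ω))) hr.le
    (by
      have := hgc.comp hsm hmaps
      apply ContinuousOn.mul (by fun_prop) this)
    (by
      intro s hs
      have hs2 : ‖s • ω‖ < r := by
        simpa [norm_smul, hω1, abs_of_pos hs.1] using hs.2
      have e1 : HasDerivAt (fun s : ℝ => s • ω) ω s := by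
        simpa using (hasDerivAt_id s).smul_const ω
      have e2 := (hd _ hs2).comp_hasDerivAt s e1
      have e3 := (hasDerivAt_pow m s).mul e2
      have e4 : HasDerivAt (fun s : ℝ => s ^ m * g (s • ω)) _ s := e3
      refine e4.congr_deriv ?_
      simp only [map_smul, smul_eq_mul, Function.comp]
      have : s ^ m = s ^ (m-1) * s := by rw [← pow_succ, Nat.sub_add_cancel hm]
      rw [this]; ring)
    (hcont'.intervalIntegrable_of_Icc hr.le)
  rw [hF]
  have : m ≠ 0 := by omega
  simp [this]

lemma pohoz_div (N : ℕ) (c : ℝ) (hc : c = ((N:ℝ) - 2) / 2) (u : EuclideanSpace ℝ (Fin N) → ℝ)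
    (q : Fin N → EuclideanSpace ℝ (Fin N) → ℝ)
    (y : EuclideanSpace ℝ (Fin N))
    (Lu : EuclideanSpace ℝ (Fin N) →L[ℝ] ℝ) (L : Fin N → EuclideanSpace ℝ (Fin N) →L[ℝ] ℝ)
    (hu : HasFDerivAt u Lu y) (hq : ∀ j, HasFDerivAt (q j) (L j) y)
    (h1 : ∀ i, Lu (EuclideanSpace.single i 1) = q i y)
    (h2 : ∀ i j, L j (EuclideanSpace.single i 1) = L i (EuclideanSpace.single j 1))
    (h3 : ∑ i, L i (EuclideanSpace.single i 1) = 0) :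
    ∑ i, fderiv ℝ (fun x => (∑ j, x j * q j x + c * u x) * q i x - 1/2 * (∑ j, q j x ^ 2) * x i) y
      (EuclideanSpace.single i 1) = 0 := by
  have hx : ∀ j : Fin N, HasFDerivAt (fun x : EuclideanSpace ℝ (Fin N) => x j)
      (EuclideanSpace.proj j : EuclideanSpace ℝ (Fin N) →L[ℝ] ℝ) y := fun j =>
    (EuclideanSpace.proj j : EuclideanSpace ℝ (Fin N) →L[ℝ] ℝ).hasFDerivAt
  have hX := (HasFDerivAt.fun_sum (u := Finset.univ) fun j _ => (hx j).mul (hq j)).add (hu.const_mul c)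
  have hQ := HasFDerivAt.fun_sum (u := Finset.univ) fun j _ => (hq j).pow 2
  have key : ∀ i, fderiv ℝ (fun x => (∑ j, x j * q j x + c * u x) * q i x - 1/2 * (∑ j, q j x ^ 2) * x i) y
      (EuclideanSpace.single i 1)
      = (1 + c) * q i y ^ 2 - 1/2 * (∑ j, q j y ^ 2) 
        + (∑ j, y j * q j y + c * u y) * L i (EuclideanSpace.single i 1)
        + (∑ j, y j * L j (EuclideanSpace.single i 1) * q i y - ∑ j, y i * L j (EuclideanSpace.single i 1) * q j y) := by
    intro i
    have hF := (hX.mul (hq i)).sub ((hQ.const_mul (1/2)).mul (hx i))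
    have hF' : HasFDerivAt (fun x => (∑ j, x j * q j x + c * u x) * q i x - 1/2 * (∑ j, q j x ^ 2) * x i) _ y := hF
    rw [hF'.fderiv]
    simp [h1, Finset.sum_add_distrib, Finset.mul_sum, Finset.sum_mul, ContinuousLinearMap.sum_apply]
    have e1 : ∑ x, q i y * (y x * (L x) (EuclideanSpace.single i 1)) = ∑ j, y j * L j (EuclideanSpace.single i 1) * q i y :=
      Finset.sum_congr rfl fun j _ => by ring
    have e2 : ∑ x, y i * (2⁻¹ * (2 * q x y * (L x) (EuclideanSpace.single i 1)))
       = ∑ j, y i * L j (EuclideanSpace.single i 1) * q j y :=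
      Finset.sum_congr rfl fun j _ => by ring
    simp only [e1, e2, Finset.mul_sum, Finset.sum_mul] at *
    try ring
  simp_rw [key]
  simp only [Finset.sum_add_distrib, Finset.sum_sub_distrib, ← Finset.mul_sum, h3]
  have e : ∑ i, ∑ j, y j * L j (EuclideanSpace.single i 1) * q i y
      = ∑ i, ∑ j, y i * L j (EuclideanSpace.single i 1) * q j y := by
    rw [Finset.sum_comm]
    exact Finset.sum_congr rfl fun i _ => Finset.sum_congr rfl fun j _ => by rw [h2]
  simp only [Finset.mul_sum] at e ⊢
  rw [e]
  simp only [Finset.sum_const, Finset.card_univ, Fintype.card_fin, nsmul_eq_mul, ← Finset.mul_sum]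
  rw [hc]; ring


def embL (m : ℕ) : EuclideanSpace ℝ (Fin m) →L[ℝ] EuclideanSpace ℝ (Fin (m+1)) :=
  LinearMap.toContinuousLinearMap
    { toFun := fun z => joinPt z 0
      map_add' := by
        intro x y; ext i
        refine Fin.lastCases ?_ (fun j => ?_) i <;> simp
      map_smul' := by
        intro a x; ext i
        refine Fin.lastCases ?_ (fun j => ?_) i <;> simp }

lemma embL_apply (m : ℕ) (z : EuclideanSpace ℝ (Fin m)) : embL m z = joinPt z 0 := rfl

lemma hbS_convex (m : ℕ) (r : ℝ) : Convex ℝ (hbS m r) := by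
  have h : hbS m r = Metric.closedBall (0 : EuclideanSpace ℝ (Fin (m+1))) r ∩
      {y | 0 ≤ (EuclideanSpace.proj (Fin.last m) : EuclideanSpace ℝ (Fin (m+1)) →L[ℝ] ℝ) y} := by
    ext y; simp [hbS]
  rw [h]
  exact (convex_closedBall _ _).inter
    (convex_halfSpace_ge (EuclideanSpace.proj (Fin.last m) : EuclideanSpace ℝ (Fin (m+1)) →L[ℝ] ℝ).toLinearMap.isLinear 0)

lemma hbS_uniqueDiff (m : ℕ) (r : ℝ) (hr : 0 < r) : UniqueDiffOn ℝ (hbS m r) := by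
  refine uniqueDiffOn_convex (hbS_convex m r) ⟨EuclideanSpace.single (Fin.last m) (r/2), ?_⟩
  refine interior_maximal (hbU_sub m r) (hbU_open m r) ?_
  simp only [hbU, Set.mem_setOf_eq, EuclideanSpace.norm_single, Real.norm_eq_abs, abs_of_pos (half_pos hr)]
  simp; exact hr

lemma clm_sum {N : ℕ} (L : EuclideanSpace ℝ (Fin N) →L[ℝ] ℝ) (y : EuclideanSpace ℝ (Fin N)) :
    L y = ∑ j, y j * L (EuclideanSpace.single j 1) := by
  have h : y = ∑ j, y j • (EuclideanSpace.single j (1:ℝ) : EuclideanSpace ℝ (Fin N)) := by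
    ext i
    simp [Finset.sum_apply, Pi.single_apply]
  conv_lhs => rw [h]
  simp [map_sum]

/-- cap part -/
lemma cap_eq (m : ℕ) (r : ℝ) (hr : 0 < r) (c : ℝ) (hc : c = (((m+1 : ℕ):ℝ) - 2) / 2)
    (u : EuclideanSpace ℝ (Fin (m+1)) → ℝ) (hu2 : ContDiffOn ℝ 2 u (hbS m r))
    (huharm : ∀ y ∈ hbU m r, ∑ i, fderivWithin ℝ (fun x => fderivWithin ℝ u (hbS m r) x (EuclideanSpace.single i 1))
      (hbS m r) y (EuclideanSpace.single i 1) = 0) :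
    r ^ m * ∫ ω in {ω : Metric.sphere (0 : EuclideanSpace ℝ (Fin (m+1))) 1 |
            0 < (ω : EuclideanSpace ℝ (Fin (m+1))) (Fin.last m)},
          (c * u (r • (ω : EuclideanSpace ℝ (Fin (m+1))))
              * fderivWithin ℝ u (hbS m r) (r • (ω : EuclideanSpace ℝ (Fin (m+1))))
                  (ω : EuclideanSpace ℝ (Fin (m+1)))
            - r / 2 * ∑ i, (fderivWithin ℝ u (hbS m r) (r • (ω : EuclideanSpace ℝ (Fin (m+1)))) (EuclideanSpace.single i 1)) ^ 2
            + r * (fderivWithin ℝ u (hbS m r) (r • (ω : EuclideanSpace ℝ (Fin (m+1))))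
                  (ω : EuclideanSpace ℝ (Fin (m+1)))) ^ 2)
            ∂((volume : Measure (EuclideanSpace ℝ (Fin (m+1)))).toSphere)
      = ∫ z in Metric.ball (0 : EuclideanSpace ℝ (Fin m)) r,
          (fderivWithin ℝ u (hbS m r) (joinPt z 0) (joinPt z 0) + c * u (joinPt z 0))
            * fderivWithin ℝ u (hbS m r) (joinPt z 0) (EuclideanSpace.single (Fin.last m) 1) := by
  set S := hbS m r with hS
  have hSu : UniqueDiffOn ℝ S := hbS_uniqueDiff m r hr
  have hDu : ContDiffOn ℝ 1 (fderivWithin ℝ u S) S := hu2.fderivWithin hSu (by norm_num)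
  set q : Fin (m+1) → EuclideanSpace ℝ (Fin (m+1)) → ℝ :=
    fun i y => fderivWithin ℝ u S y (EuclideanSpace.single i 1) with hq
  have hqd : ∀ i, ContDiffOn ℝ 1 (q i) S := fun i => hDu.clm_apply contDiffOn_const
  have hu1 : ContDiffOn ℝ 1 u S := hu2.of_le (by norm_num)
  have hproj : ∀ i : Fin (m+1), ContDiff ℝ 1 (fun x : EuclideanSpace ℝ (Fin (m+1)) => x i) := fun i =>
    (EuclideanSpace.proj i : EuclideanSpace ℝ (Fin (m+1)) →L[ℝ] ℝ).contDiff
  set F : Fin (m+1) → EuclideanSpace ℝ (Fin (m+1)) → ℝ := fun i x =>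
    (∑ j, x j * q j x + c * u x) * q i x - 1/2 * (∑ j, q j x ^ 2) * x i with hF
  have hFS : ∀ i, ContDiffOn ℝ 1 (F i) S := by
    intro i
    have h1 : ContDiffOn ℝ 1 (fun x => ∑ j, x j * q j x) S :=
      ContDiffOn.sum fun j _ => (hproj j).contDiffOn.mul (hqd j)
    have h2 : ContDiffOn ℝ 1 (fun x => ∑ j, q j x ^ 2) S :=
      ContDiffOn.sum fun j _ => (hqd j).pow 2
    exact ((h1.add (contDiffOn_const.mul hu1)).mul (hqd i)).sub
      ((contDiffOn_const.mul h2).mul (hproj i).contDiffOn)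
  have hdiv : ∀ y ∈ hbU m r, ∑ i, fderiv ℝ (F i) y (EuclideanSpace.single i 1) = 0 := by
    intro y hy
    have hSn : ∀ x ∈ hbU m r, S ∈ nhds x := fun x hx =>
      Filter.mem_of_superset ((hbU_open m r).mem_nhds hx) (hbU_sub m r)
    have huat : ContDiffAt ℝ 2 u y := hu2.contDiffAt (hSn y hy)
    have hqe : ∀ j, q j =ᶠ[nhds y] fun x => fderiv ℝ u x (EuclideanSpace.single j 1) := by
      intro j
      filter_upwards [(hbU_open m r).mem_nhds hy] with x hx
      simp only [hq, fderivWithin_of_mem_nhds (hSn x hx)]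
    have hd1 : DifferentiableAt ℝ (fderiv ℝ u) y :=
      (huat.fderiv_right (m := 1) (by norm_num)).differentiableAt (by norm_num)
    have hqdf : ∀ j, DifferentiableAt ℝ (q j) y := fun j =>
      (((hqd j).contDiffAt (hSn y hy)).differentiableAt (by norm_num))
    have hqv : ∀ i j, fderiv ℝ (q j) y (EuclideanSpace.single i 1)
        = fderiv ℝ (fderiv ℝ u) y (EuclideanSpace.single i 1) (EuclideanSpace.single j 1) := by
      intro i j
      rw [(hqe j).fderiv_eq, fderiv_clm_apply hd1 (differentiableAt_const _)]
      simp
    refine pohoz_div (m+1) c hc u q y (fderiv ℝ u y) (fun j => fderiv ℝ (q j) y)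
      (huat.differentiableAt (by norm_num)).hasFDerivAt (fun j => (hqdf j).hasFDerivAt) ?_ ?_ ?_
    · intro i
      simp only [hq, fderivWithin_of_mem_nhds (hSn y hy)]
    · intro i j
      simp only [hqv]
      exact (huat.isSymmSndFDerivAt (by simp)).eq _ _
    · have := huharm y hy
      rw [← this]
      refine Finset.sum_congr rfl fun i _ => ?_
      rw [fderivWithin_of_mem_nhds (hSn y hy)]
  have key := div_thm m r hr F (fun i => (hFS i).continuousOn) (fun i => (hFS i).mono (hbU_sub m r)) hdiv
  have hsum : ∀ ω : Metric.sphere (0 : EuclideanSpace ℝ (Fin (m+1))) 1,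
      ∑ i, F i (r • (ω : EuclideanSpace ℝ (Fin (m+1)))) * (ω : EuclideanSpace ℝ (Fin (m+1))) i
      = (c * u (r • (ω : EuclideanSpace ℝ (Fin (m+1))))
              * fderivWithin ℝ u S (r • (ω : EuclideanSpace ℝ (Fin (m+1))))
                  (ω : EuclideanSpace ℝ (Fin (m+1)))
            - r / 2 * ∑ i, (fderivWithin ℝ u S (r • (ω : EuclideanSpace ℝ (Fin (m+1)))) (EuclideanSpace.single i 1)) ^ 2
            + r * (fderivWithin ℝ u S (r • (ω : EuclideanSpace ℝ (Fin (m+1))))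
                  (ω : EuclideanSpace ℝ (Fin (m+1)))) ^ 2) := by
    intro w
    have hw1 : ‖(w : EuclideanSpace ℝ (Fin (m+1)))‖ = 1 := by simp
    generalize (w : EuclideanSpace ℝ (Fin (m+1))) = ω at hw1
    have hω2 : ∑ i, ω i ^ 2 = 1 := by
      have := EuclideanSpace.real_norm_sq_eq ω
      rw [hw1] at this; rw [← this]; norm_num
    have hD : fderivWithin ℝ u S (r • ω) ω = ∑ j, ω j * q j (r • ω) := clm_sum _ _
    rw [hD]
    set A := ∑ j, ω j * q j (r • ω) with hA
    set B := ∑ j, q j (r • ω) ^ 2 with hB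
    have hFi : ∀ i, F i (r • ω) * ω i = (r * A + c * u (r • ω)) * (ω i * q i (r • ω)) - 1/2 * B * r * ω i ^ 2 := by
      intro i
      have : ∑ j, (r • ω) j * q j (r • ω) = r * A := by
        rw [hA, Finset.mul_sum]
        exact Finset.sum_congr rfl fun j _ => by simp; ring
      simp only [hF, this, ← hB]
      simp; ring
    rw [Finset.sum_congr rfl fun i _ => hFi i, Finset.sum_sub_distrib, ← Finset.mul_sum, ← Finset.mul_sum, hω2]
    rw [← hA]
    ring
  simp only [hsum] at key
  rw [key]
  refine setIntegral_congr_fun measurableSet_ball fun z _ => ?_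
  simp only [hF]
  rw [clm_sum (fderivWithin ℝ u S (joinPt z 0)) (joinPt z 0)]
  simp [hq]


lemma pohoz_core (m : ℕ) (hm : 2 ≤ m) (r : ℝ) (hr : 0 < r) (p τ : ℝ) (hp : 1 < p)
    (f : EuclideanSpace ℝ (Fin m) → ℝ) (V : Set (EuclideanSpace ℝ (Fin m))) (hV : IsOpen V)
    (hVr : Metric.closedBall (0 : EuclideanSpace ℝ (Fin m)) r ⊆ V)
    (hf : ContDiffOn ℝ 1 f V) (hfpos : ∀ z ∈ V, 0 < f z)
    (u : EuclideanSpace ℝ (Fin (m+1)) → ℝ) (hu2 : ContDiffOn ℝ 2 u (hbS m r))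
    (hupos : ∀ y ∈ hbS m r, 0 < u y)
    (huharm : ∀ y ∈ hbU m r, ∑ i, fderivWithin ℝ (fun x => fderivWithin ℝ u (hbS m r) x (EuclideanSpace.single i 1))
      (hbS m r) y (EuclideanSpace.single i 1) = 0)
    (hubc : ∀ z : EuclideanSpace ℝ (Fin m), ‖z‖ < r →
        fderivWithin ℝ u (hbS m r) (joinPt z 0) (EuclideanSpace.single (Fin.last m) 1)
          + (((m+1 : ℕ) : ℝ) - 2) * f z ^ (-τ) * u (joinPt z 0) ^ p = 0) :
    (r ^ m * ∫ ω in {ω : Metric.sphere (0 : EuclideanSpace ℝ (Fin (m+1))) 1 |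
            0 < (ω : EuclideanSpace ℝ (Fin (m+1))) (Fin.last m)},
          ((((m+1 : ℕ) : ℝ) - 2) / 2 * u (r • (ω : EuclideanSpace ℝ (Fin (m+1))))
              * fderivWithin ℝ u (hbS m r) (r • (ω : EuclideanSpace ℝ (Fin (m+1))))
                  (ω : EuclideanSpace ℝ (Fin (m+1)))
            - r / 2 * ∑ i, (fderivWithin ℝ u (hbS m r) (r • (ω : EuclideanSpace ℝ (Fin (m+1)))) (EuclideanSpace.single i 1)) ^ 2
            + r * (fderivWithin ℝ u (hbS m r) (r • (ω : EuclideanSpace ℝ (Fin (m+1))))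
                  (ω : EuclideanSpace ℝ (Fin (m+1)))) ^ 2)
            ∂((volume : Measure (EuclideanSpace ℝ (Fin (m+1)))).toSphere))
      + r * (((m+1 : ℕ) : ℝ) - 2) / (p + 1) *
          (r ^ (m - 1) *
            ∫ ζ : Metric.sphere (0 : EuclideanSpace ℝ (Fin m)) 1,
              f (r • (ζ : EuclideanSpace ℝ (Fin m))) ^ (-τ)
                * u (joinPt (r • (ζ : EuclideanSpace ℝ (Fin m))) 0) ^ (p + 1)
              ∂((volume : Measure (EuclideanSpace ℝ (Fin m))).toSphere))
      = -(τ * (((m+1 : ℕ) : ℝ) - 2) / (p + 1)) *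
            (∫ z in Metric.ball (0 : EuclideanSpace ℝ (Fin m)) r,
              (∑ k : Fin m, z k * fderiv ℝ f z (EuclideanSpace.single k 1))
                * f z ^ (-τ - 1) * u (joinPt z 0) ^ (p + 1))
        + ((((m+1 : ℕ) : ℝ) - 1) / (p + 1) - (((m+1 : ℕ) : ℝ) - 2) / 2) * (((m+1 : ℕ) : ℝ) - 2) *
            (∫ z in Metric.ball (0 : EuclideanSpace ℝ (Fin m)) r,
              f z ^ (-τ) * u (joinPt z 0) ^ (p + 1)) := by
  rw [cap_eq m r hr _ rfl u hu2 huharm]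
  set S := hbS m r with hS
  set c : ℝ := (((m+1 : ℕ) : ℝ) - 2) / 2 with hc
  have hSu : UniqueDiffOn ℝ S := hbS_uniqueDiff m r hr
  have hDuc : ContinuousOn (fderivWithin ℝ u S) S :=
    (hu2.fderivWithin (m := 1) hSu (by norm_num)).continuousOn
  have hJS : ∀ z : EuclideanSpace ℝ (Fin m), ‖z‖ ≤ r → joinPt z 0 ∈ S := by
    intro z hz
    refine ⟨?_, by simp⟩
    have := joinPt_norm_sq z 0
    have h2 : ‖joinPt z 0‖ = ‖z‖ := by
      rw [← sq_eq_sq₀ (norm_nonneg _) (norm_nonneg _), this]; ring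
    rw [h2]; exact hz
  have hJm : Set.MapsTo (fun z : EuclideanSpace ℝ (Fin m) => joinPt z 0) (Metric.closedBall 0 r) S :=
    fun z hz => hJS z (by simpa using hz)
  have hJc : ContinuousOn (fun z : EuclideanSpace ℝ (Fin m) => joinPt z 0) (Metric.closedBall 0 r) :=
    (embL m).continuous.continuousOn
  have huc : ContinuousOn (fun z : EuclideanSpace ℝ (Fin m) => u (joinPt z 0)) (Metric.closedBall 0 r) :=
    hu2.continuousOn.comp hJc hJm
  have hup : ∀ z ∈ Metric.closedBall (0 : EuclideanSpace ℝ (Fin m)) r, 0 < u (joinPt z 0) :=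
    fun z hz => hupos _ (hJm hz)
  have hfc : ContinuousOn f (Metric.closedBall 0 r) := hf.continuousOn.mono hVr
  have hdfc : ContinuousOn (fderiv ℝ f) (Metric.closedBall 0 r) :=
    (hf.continuousOn_fderiv_of_isOpen hV (by norm_num)).mono hVr
  have hfa : ∀ a : ℝ, ContinuousOn (fun z => f z ^ a) (Metric.closedBall 0 r) := fun a =>
    hfc.rpow_const fun z hz => Or.inl (hfpos z (hVr hz)).ne'
  have hua : ∀ a : ℝ, ContinuousOn (fun z : EuclideanSpace ℝ (Fin m) => u (joinPt z 0) ^ a) (Metric.closedBall 0 r) := fun a =>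
    huc.rpow_const fun z hz => Or.inl (hup z hz).ne'
  have hE : ContinuousOn (fun z : EuclideanSpace ℝ (Fin m) => fderivWithin ℝ u S (joinPt z 0) (joinPt z 0))
      (Metric.closedBall 0 r) := (hDuc.comp hJc hJm).clm_apply hJc
  have hG : ContinuousOn (fun z : EuclideanSpace ℝ (Fin m) => fderiv ℝ f z z)
      (Metric.closedBall 0 r) := hdfc.clm_apply continuousOn_id
  have hint : ∀ g : EuclideanSpace ℝ (Fin m) → ℝ, ContinuousOn g (Metric.closedBall 0 r) →
      IntegrableOn g (Metric.ball 0 r) := fun g hg =>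
    (hg.integrableOn_compact (isCompact_closedBall _ _)).mono_set Metric.ball_subset_closedBall
  have cA : ContinuousOn (fun z : EuclideanSpace ℝ (Fin m) => f z ^ (-τ) * u (joinPt z 0) ^ p
      * fderivWithin ℝ u S (joinPt z 0) (joinPt z 0)) (Metric.closedBall 0 r) :=
    ((hfa _).mul (hua _)).mul hE
  have cB : ContinuousOn (fun z : EuclideanSpace ℝ (Fin m) => f z ^ (-τ) * u (joinPt z 0) ^ (p+1))
      (Metric.closedBall 0 r) := (hfa _).mul (hua _)
  have cT : ContinuousOn (fun z : EuclideanSpace ℝ (Fin m) => fderiv ℝ f z z * f z ^ (-τ-1) * u (joinPt z 0) ^ (p+1))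
      (Metric.closedBall 0 r) := (hG.mul (hfa _)).mul (hua _)
  have iA := hint _ cA
  have iB := hint _ cB
  have iT := hint _ cT
  set D : EuclideanSpace ℝ (Fin m) → EuclideanSpace ℝ (Fin m) →L[ℝ] ℝ := fun z =>
    (f z ^ (-τ)) • (((p+1) * u (joinPt z 0) ^ (p+1-1)) • (fderivWithin ℝ u S (joinPt z 0)).comp (embL m))
     + (u (joinPt z 0) ^ (p+1)) • ((-τ * f z ^ (-τ-1)) • fderiv ℝ f z) with hD
  have hDv : ∀ z, D z z = (p+1) * (f z ^ (-τ) * u (joinPt z 0) ^ p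
      * fderivWithin ℝ u S (joinPt z 0) (joinPt z 0)) - τ * (fderiv ℝ f z z * f z ^ (-τ-1) * u (joinPt z 0) ^ (p+1)) := by
    intro z
    simp only [hD, add_sub_cancel_right, ContinuousLinearMap.add_apply, ContinuousLinearMap.smul_apply,
      ContinuousLinearMap.comp_apply, embL_apply, smul_eq_mul]
    ring
  have hd : ∀ z, ‖z‖ < r → HasFDerivAt (fun z : EuclideanSpace ℝ (Fin m) => f z ^ (-τ) * u (joinPt z 0) ^ (p+1)) (D z) z := by
    intro z hz
    have hzV : z ∈ V := hVr (by simpa using hz.le)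
    have h1 : HasFDerivAt f (fderiv ℝ f z) z :=
      ((hf.contDiffAt (hV.mem_nhds hzV)).differentiableAt (by norm_num)).hasFDerivAt
    have h2 : HasFDerivWithinAt u (fderivWithin ℝ u S (embL m z)) S (embL m z) :=
      (hu2.differentiableOn (by norm_num) _ (hJS z hz.le)).hasFDerivWithinAt
    have h3 : HasFDerivWithinAt (fun z : EuclideanSpace ℝ (Fin m) => u (joinPt z 0))
        ((fderivWithin ℝ u S (embL m z)).comp (embL m)) (Metric.ball 0 r) z :=
      h2.comp z (embL m).hasFDerivAt.hasFDerivWithinAt (fun x hx => hJm (Metric.ball_subset_closedBall hx))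
    have h4 := h3.hasFDerivAt (Metric.isOpen_ball.mem_nhds (by simpa using hz))
    have hfp := hfpos z hzV
    have hupz := hupos _ (hJS z hz.le)
    exact (h1.rpow_const (p := -τ) (Or.inl hfp.ne')).mul (h4.rpow_const (p := p+1) (Or.inl hupz.ne'))
  have hDc : ContinuousOn (fun z => D z z) (Metric.closedBall 0 r) := by
    simp only [hDv]
    exact (continuousOn_const.mul cA).sub (continuousOn_const.mul cT)
  have ftc := flat_ftc m (by omega) r hr _ D cB hd hDc
  simp only [hDv] at ftc
  have hT : ∀ z : EuclideanSpace ℝ (Fin m), ∑ k : Fin m, z k * fderiv ℝ f z (EuclideanSpace.single k 1) = fderiv ℝ f z z :=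
    fun z => (clm_sum _ _).symm
  simp only [hT]
  have iAT : Integrable (fun z : EuclideanSpace ℝ (Fin m) => (p+1) * (f z ^ (-τ) * u (joinPt z 0) ^ p
      * fderivWithin ℝ u S (joinPt z 0) (joinPt z 0)) - τ * (fderiv ℝ f z z * f z ^ (-τ-1) * u (joinPt z 0) ^ (p+1)))
      (volume.restrict (Metric.ball 0 r)) := (iA.const_mul _).sub (iT.const_mul _)
  rw [integral_add (iB.const_mul _) iAT,
    integral_sub (iA.const_mul _) (iT.const_mul _), integral_const_mul, integral_const_mul, integral_const_mul] at ftc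
  have hcap : ∫ z in Metric.ball (0 : EuclideanSpace ℝ (Fin m)) r,
          (fderivWithin ℝ u S (joinPt z 0) (joinPt z 0) + c * u (joinPt z 0))
            * fderivWithin ℝ u S (joinPt z 0) (EuclideanSpace.single (Fin.last m) 1)
      = -(2 * c) * ((∫ z in Metric.ball (0 : EuclideanSpace ℝ (Fin m)) r, f z ^ (-τ) * u (joinPt z 0) ^ p
      * fderivWithin ℝ u S (joinPt z 0) (joinPt z 0)) + c * ∫ z in Metric.ball (0 : EuclideanSpace ℝ (Fin m)) r, f z ^ (-τ) * u (joinPt z 0) ^ (p+1)) := by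
    rw [← integral_const_mul, ← integral_add iA (iB.const_mul _), ← integral_const_mul]
    refine setIntegral_congr_fun measurableSet_ball fun z hz => ?_
    have hz' : ‖z‖ < r := by simpa using hz
    have hb := hubc z hz'
    have hb' : fderivWithin ℝ u S (joinPt z 0) (EuclideanSpace.single (Fin.last m) 1)
        = -(2 * c * f z ^ (-τ) * u (joinPt z 0) ^ p) := by
      rw [hc]; linarith
    have hu' : u (joinPt z 0) ^ (p+1) = u (joinPt z 0) ^ p * u (joinPt z 0) := by
      rw [Real.rpow_add (hupos _ (hJS z hz'.le)), Real.rpow_one]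
    simp only [hb', hu']
    ring
  rw [hcap]
  have hrm : r ^ m = r ^ (m-1) * r := by rw [← pow_succ, Nat.sub_add_cancel (by omega)]
  rw [hrm] at ftc
  have hcm : (((m+1 : ℕ) : ℝ) - 1) = m := by push_cast; ring
  have hc2 : (((m+1 : ℕ) : ℝ) - 2) = 2 * c := by rw [hc]; ring
  rw [hcm, hc2]
  have hp1 : p + 1 ≠ 0 := by linarith
  generalize (∫ z in Metric.ball (0 : EuclideanSpace ℝ (Fin m)) r, f z ^ (-τ) * u (joinPt z 0) ^ p
      * fderivWithin ℝ u S (joinPt z 0) (joinPt z 0)) = A at *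
  generalize (∫ z in Metric.ball (0 : EuclideanSpace ℝ (Fin m)) r, f z ^ (-τ) * u (joinPt z 0) ^ (p+1)) = B at *
  generalize (∫ z in Metric.ball (0 : EuclideanSpace ℝ (Fin m)) r, fderiv ℝ f z z * f z ^ (-τ-1) * u (joinPt z 0) ^ (p+1)) = T at *
  generalize (∫ ζ : Metric.sphere (0 : EuclideanSpace ℝ (Fin m)) 1,
      f (r • (ζ : EuclideanSpace ℝ (Fin m))) ^ (-τ)
        * u (joinPt (r • (ζ : EuclideanSpace ℝ (Fin m))) 0) ^ (p + 1)
      ∂((volume : Measure (EuclideanSpace ℝ (Fin m))).toSphere)) = E at *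
  have hA : A = (r ^ (m-1) * r * E - m * B + τ * T) / (p + 1) := by
    rw [eq_div_iff hp1]
    linear_combination ftc
  rw [hA]
  ring

/-- **Pohozaev identity, Euclidean case.** Let `u > 0` be `C²` on
`S := closedBall(0,r) ∩ ℝⁿ₊`, harmonic in the open half-ball `B_r⁺`, satisfying
`∂u/∂yₙ + (n-2) f^{-τ} u^p = 0` on the flat boundary `∂'B_r⁺`, where `f` is positive
and `C¹` on an open neighborhood `V` of the closed disk and `τ = n/(n-2) - p`. Then,
with the spherical-cap integral over `∂⁺B_r⁺ = {|y|=r, yₙ>0}` written as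
`r^{n-1} ∫_{ω ∈ S^{n-1}, ωₙ>0} F(rω) dσ(ω)` and the edge integral over
`∂(∂'B_r⁺) = {|ȳ|=r, yₙ=0}` written as `r^{n-2} ∫_{ζ ∈ S^{n-2}} G(rζ) dσ̄(ζ)`:
`P(u,r) = -(τ(n-2)/(p+1)) ∫_{∂'B_r⁺} (ȳ·∇̄f) f^{-τ-1} u^{p+1} dȳ
  + ((n-1)/(p+1) - (n-2)/2)(n-2) ∫_{∂'B_r⁺} f^{-τ} u^{p+1} dȳ`. -/
theorem statement17 (n : ℕ) [NeZero n] (hn : 3 ≤ n) (r : ℝ) (hr : 0 < r)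
    (p τ : ℝ) (hp : 1 < p) (hτ : τ = (n : ℝ) / ((n : ℝ) - 2) - p)
    (f : EuclideanSpace ℝ (Fin (n - 1)) → ℝ)
    (V : Set (EuclideanSpace ℝ (Fin (n - 1)))) (hV : IsOpen V)
    (hVr : Metric.closedBall (0 : EuclideanSpace ℝ (Fin (n - 1))) r ⊆ V)
    (hf : ContDiffOn ℝ 1 f V) (hfpos : ∀ z ∈ V, 0 < f z)
    (u : EuclideanSpace ℝ (Fin n) → ℝ)
    (hu2 : ContDiffOn ℝ 2 u (domS n r))
    (hupos : ∀ y ∈ domS n r, 0 < u y)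
    (huharm : ∀ y : EuclideanSpace ℝ (Fin n), ‖y‖ < r → 0 < lastCoord n y →
        ∑ i : Fin n, pdW n r (pdW n r u i) i y = 0)
    (hubc : ∀ z : EuclideanSpace ℝ (Fin (n - 1)), ‖z‖ < r →
        pdW n r u (lastIdx n) (embBdry n z)
          + ((n : ℝ) - 2) * f z ^ (-τ) * u (embBdry n z) ^ p = 0) :
    (r ^ (n - 1) *
        ∫ ω in {ω : Metric.sphere (0 : EuclideanSpace ℝ (Fin n)) 1 |
            0 < lastCoord n (ω : EuclideanSpace ℝ (Fin n))},
          (((n : ℝ) - 2) / 2 * u (r • (ω : EuclideanSpace ℝ (Fin n)))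
              * fderivWithin ℝ u (domS n r) (r • (ω : EuclideanSpace ℝ (Fin n)))
                  (ω : EuclideanSpace ℝ (Fin n))
            - r / 2 * ∑ i : Fin n, (pdW n r u i (r • (ω : EuclideanSpace ℝ (Fin n)))) ^ 2
            + r * (fderivWithin ℝ u (domS n r) (r • (ω : EuclideanSpace ℝ (Fin n)))
                  (ω : EuclideanSpace ℝ (Fin n))) ^ 2) ∂(sphereMeasure n))
      + r * ((n : ℝ) - 2) / (p + 1) *
          (r ^ (n - 2) *
            ∫ ζ : Metric.sphere (0 : EuclideanSpace ℝ (Fin (n - 1))) 1,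
              f (r • (ζ : EuclideanSpace ℝ (Fin (n - 1)))) ^ (-τ)
                * u (embBdry n (r • (ζ : EuclideanSpace ℝ (Fin (n - 1))))) ^ (p + 1)
              ∂(sphereMeasure (n - 1)))
      = -(τ * ((n : ℝ) - 2) / (p + 1)) *
            (∫ z in Metric.ball (0 : EuclideanSpace ℝ (Fin (n - 1))) r,
              (∑ k : Fin (n - 1), z k * fderiv ℝ f z (EuclideanSpace.single k 1))
                * f z ^ (-τ - 1) * u (embBdry n z) ^ (p + 1))
        + (((n : ℝ) - 1) / (p + 1) - ((n : ℝ) - 2) / 2) * ((n : ℝ) - 2) *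
            (∫ z in Metric.ball (0 : EuclideanSpace ℝ (Fin (n - 1))) r,
              f z ^ (-τ) * u (embBdry n z) ^ (p + 1)) := by
  obtain ⟨m, rfl⟩ : ∃ m, n = m + 1 := ⟨n - 1, by omega⟩
  have hS : domS (m+1) r = hbS m r := by
    ext y
    simp [domS, hbS, halfSpace, lastCoord]
    intro _
    rfl
  have hJ : ∀ z : EuclideanSpace ℝ (Fin m), embBdry (m+1) z = joinPt z 0 := by
    intro z
    ext i
    refine Fin.lastCases ?_ (fun j => ?_) i
    · simp [embBdry]
    · simp [embBdry]
  have hpd : ∀ i, pdW (m+1) r u i = fun x => fderivWithin ℝ u (hbS m r) x (EuclideanSpace.single i 1) := by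
    intro i
    funext x
    simp only [pdW, hS]
  have h := pohoz_core m (by omega) r hr p τ hp f V hV hVr hf hfpos u (hS ▸ hu2) (hS ▸ hupos)
    (by
      intro y hy
      have := huharm y hy.1 hy.2
      simp only [hpd] at this
      simp only [pdW, hS] at this
      exact this)
    (by
      intro z hz
      have := hubc z hz
      simp only [pdW, hS] at this
      have hJz := hJ z
      change embBdry (m+1) z = _ at hJz
      rw [← hJ z]
      exact this)
  simp only [pdW, hS, sphereMeasure]
  simp only [← hJ] at h
  exact h
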